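/- Let k ≥ 2 and let (Ω_j)_{j ∈ ℕ} be an increasing sequence (Ω_j ⊆ Ω_{j+1}) of open subsets of ℂ^k such that each Ω_j is Runge and each Ω_j is biholomorphic to ℂ^k (there exists an injective entire map F_j : ℂ^k → ℂ^k with range F_j = Ω_j). Then the union Ω = ⋃_{j=1}^∞ Ω_j is biholomorphic to ℂ^k: there exists an injective entire map F : ℂ^k → ℂ^k with range F = Ω. -/

import Mathlib

open Metric Set Filter

noncomputable section

/-- An open set `Ω ⊆ ℂ^k` is Runge if every function holomorphic on `Ω` can be approximated
uniformly on compact subsets of `Ω` by polynomials. -/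
def IsRunge {k : ℕ} (Ω : Set (EuclideanSpace ℂ (Fin k))) : Prop :=
  ∀ f : EuclideanSpace ℂ (Fin k) → ℂ, DifferentiableOn ℂ f Ω →
    ∀ K ⊆ Ω, IsCompact K → ∀ ε > (0 : ℝ),
      ∃ P : MvPolynomial (Fin k) ℂ,
        ∀ z ∈ K, ‖f z - MvPolynomial.eval (fun i => z i) P‖ < ε

open scoped Topology in
lemma holo_limit {V W : Type} [NormedAddCommGroup V] [NormedSpace ℂ V]
    [NormedAddCommGroup W] [NormedSpace ℂ W] [CompleteSpace W]
    {G : ℕ → V → W} {g : V → W} {U : Set V} (hU : IsOpen U)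
    (hG : ∀ᶠ n in atTop, DifferentiableOn ℂ (G n) U)
    (h : TendstoUniformlyOn G g atTop U) : DifferentiableOn ℂ g U := by
  intro x hx
  obtain ⟨r, hr, hrU⟩ : ∃ r > 0, ball x (2 * r) ⊆ U := by
    obtain ⟨r, hr, h⟩ := Metric.isOpen_iff.1 hU x hx
    exact ⟨r / 2, by positivity, by convert h using 2; ring⟩
  have hsub : ∀ y ∈ ball x r, ball y r ⊆ U := by
    intro y hy z hz
    apply hrU
    rw [mem_ball] at *
    linarith [dist_triangle z y x]
  obtain ⟨N0, hN0⟩ := eventually_atTop.1 hG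
  have hdiff : ∀ n ≥ N0, ∀ y ∈ ball x r, DifferentiableAt ℂ (G n) y := fun n hn y hy =>
    (hN0 n hn).differentiableAt (hU.mem_nhds (hsub y hy (mem_ball_self hr)))
  have hC : UniformCauchySeqOn (fun n => fderiv ℂ (G n)) atTop (ball x r) := by
    rw [Metric.uniformCauchySeqOn_iff]
    intro ε hε
    have hc := h.uniformCauchySeqOn
    rw [Metric.uniformCauchySeqOn_iff] at hc
    obtain ⟨N, hN⟩ := hc (ε * r / 4) (by positivity)
    refine ⟨max N N0, fun m hm n hn y hy => ?_⟩
    have hm0 := hdiff m (le_trans (le_max_right _ _) hm) y hy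
    have hn0 := hdiff n (le_trans (le_max_right _ _) hn) y hy
    rw [dist_eq_norm, ← fderiv_sub hm0 hn0]
    have hle : ∀ z ∈ ball y r, ‖(G m - G n) z‖ ≤ ε * r / 4 := by
      intro z hz
      have := hN m (le_trans (le_max_left _ _) hm) n (le_trans (le_max_left _ _) hn) z (hsub y hy hz)
      rw [dist_eq_norm] at this
      exact this.le
    have := Complex.norm_fderiv_le_div_of_mapsTo_ball (f := G m - G n) (c := y) (R₁ := r)
      (R₂ := ε * r / 2)
      (((hN0 m (le_trans (le_max_right _ _) hm)).sub
        (hN0 n (le_trans (le_max_right _ _) hn))).mono (hsub y hy)) (by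
        intro z hz
        rw [mem_closedBall, dist_eq_norm]
        have h1 := hle z hz
        have h2 := hle y (mem_ball_self hr)
        linarith [norm_sub_le ((G m - G n) z) ((G m - G n) y)]) hr
    have h3 : ε * r / 2 / r = ε / 2 := by field_simp
    linarith
  have hlim : ∀ y ∈ ball x r, ∃ L, Tendsto (fun n => fderiv ℂ (G n) y) atTop (𝓝 L) := by
    intro y hy
    exact cauchySeq_tendsto_of_complete (hC.cauchySeq hy)
  choose! g' hg' using hlim
  have hU' := hC.tendstoUniformlyOn_of_tendsto hg'
  refine (hasFDerivAt_of_tendstoUniformlyOnFilter (l := atTop) (f := G) (g := g) (g' := g')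
    (f' := fun n => fderiv ℂ (G n)) (x := x) ?_ ?_ ?_).differentiableAt.differentiableWithinAt
  · exact (tendstoUniformlyOn_iff_tendstoUniformlyOnFilter.1 hU').mono_right
      (le_principal_iff.2 (ball_mem_nhds x hr))
  · filter_upwards [prod_mem_prod (Ici_mem_atTop N0) (ball_mem_nhds x hr)] with p hp
    exact (hdiff p.1 hp.1 p.2 hp.2).hasFDerivAt
  · filter_upwards [hU.mem_nhds hx] with y hy
    exact h.tendsto_at hy

/-- second order Taylor estimate -/
lemma holo_taylor {V W : Type} [NormedAddCommGroup V] [NormedSpace ℂ V]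
    [NormedAddCommGroup W] [NormedSpace ℂ W]
    {f : V → W} {c : V} {r M : ℝ} (hr : 0 < r) (hf : DifferentiableOn ℂ f (ball c r))
    (hM : ∀ z ∈ ball c r, ‖f z - f c‖ ≤ M) (z : V) (hz : z ∈ ball c r) :
    ‖f z - f c - fderiv ℂ f c (z - c)‖ ≤ 2 * M * (‖z - c‖ / r) ^ 2 := by
  have hd : DifferentiableAt ℂ f c := hf.differentiableAt (ball_mem_nhds c hr)
  have hb : ‖fderiv ℂ f c‖ ≤ M / r :=
    Complex.norm_fderiv_le_div_of_mapsTo_ball hf (fun z hz => by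
      rw [mem_closedBall, dist_eq_norm]; exact hM z hz) hr
  have hM0 : 0 ≤ M := le_trans (norm_nonneg _) (hM c (mem_ball_self hr))
  have := Complex.dist_le_mul_div_pow_of_mapsTo_ball_of_isLittleO
    (f := fun z => f z - fderiv ℂ f c (z - c)) (c := c) (z := z) (R₁ := r) (R₂ := 2 * M) (n := 1)
    (by
      apply hf.sub
      apply Differentiable.differentiableOn
      fun_prop) (by
      intro w hw
      rw [mem_closedBall, dist_eq_norm]
      have h1 := hM w hw
      have h2 : ‖fderiv ℂ f c (w - c)‖ ≤ M := by
        refine (ContinuousLinearMap.le_opNorm _ _).trans ?_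
        have : ‖w - c‖ ≤ r := by rw [← dist_eq_norm]; exact (mem_ball.1 hw).le
        calc _ ≤ M / r * r := by gcongr
          _ = M := by field_simp
      have h3 := norm_sub_le (f w - f c) (fderiv ℂ f c (w - c))
      have h4 : f w - fderiv ℂ f c (w - c) - (f c - fderiv ℂ f c (c - c))
        = (f w - f c) - fderiv ℂ f c (w - c) := by simp; abel
      rw [h4]; linarith) (by
      have := hd.hasFDerivAt.isLittleO
      have h2 := this.norm_right
      refine h2.congr (fun w => ?_) (fun w => by simp)
      simp; abel) hz
  rw [dist_eq_norm, dist_eq_norm] at this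
  refine le_trans (le_of_eq ?_) this
  congr 1; simp; abel

open scoped Topology in
lemma holo_fderiv_apply {V W : Type} [NormedAddCommGroup V] [NormedSpace ℂ V]
    [NormedAddCommGroup W] [NormedSpace ℂ W] [CompleteSpace W]
    {f : V → W} {U : Set V} (hU : IsOpen U) (hf : DifferentiableOn ℂ f U) (v : V) :
    DifferentiableOn ℂ (fun x => fderiv ℂ f x v) U := by
  intro x hx
  -- bounded ball
  have hcont : ContinuousAt f x := (hf.differentiableAt (hU.mem_nhds hx)).continuousAt
  obtain ⟨r, hr, hrU⟩ : ∃ r > 0, ball x (2 * r) ⊆ U ∩ {y | dist (f y) (f x) < 1} := by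
    have h1 : U ∩ {y | dist (f y) (f x) < 1} ∈ 𝓝 x :=
      inter_mem (hU.mem_nhds hx) (hcont (ball_mem_nhds _ one_pos))
    obtain ⟨r, hr, h⟩ := Metric.mem_nhds_iff.1 h1
    exact ⟨r / 2, by positivity, by convert h using 2; ring⟩
  have hsub : ∀ y ∈ ball x r, ball y r ⊆ ball x (2 * r) := by
    intro y hy z hz
    rw [mem_ball] at *
    linarith [dist_triangle z y x]
  let H : ℕ → ℂ := fun n => ((1 / (n + 1 : ℝ) : ℝ) : ℂ)
  have hH0 : ∀ n, H n ≠ 0 := by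
    intro n
    have : (0 : ℝ) < 1 / (n + 1 : ℝ) := by positivity
    simp only [H]
    exact_mod_cast this.ne'
  have hHlim : Tendsto (fun n => ‖H n‖) atTop (𝓝 0) := by
    have := tendsto_one_div_add_atTop_nhds_zero_nat (𝕜 := ℝ)
    refine this.congr (fun n => ?_)
    simp only [H]
    rw [Complex.norm_real, Real.norm_of_nonneg (by positivity)]
  have hev : ∀ᶠ n in atTop, ‖H n • v‖ < r := by
    have : Tendsto (fun n => ‖H n • v‖) atTop (𝓝 0) := by
      simpa [norm_smul] using hHlim.mul_const ‖v‖
    exact this.eventually (gt_mem_nhds hr)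
  have hmem : ∀ y ∈ ball x r, ∀ n, ‖H n • v‖ < r → y + H n • v ∈ ball y r := by
    intro y hy n hn
    simpa [mem_ball, dist_eq_norm] using hn
  have key : DifferentiableOn ℂ (fun x => fderiv ℂ f x v) (ball x r) := by
    apply holo_limit (G := fun n y => (H n)⁻¹ • (f (y + H n • v) - f y)) isOpen_ball
    · filter_upwards [hev] with n hn
      apply DifferentiableOn.const_smul
      apply DifferentiableOn.sub
      · apply DifferentiableOn.comp (t := U) hf
        · apply Differentiable.differentiableOn; fun_prop
        · intro y hy
          exact (hrU (hsub y hy (hmem y hy n hn))).1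
      · exact hf.mono (fun y hy => (hrU (hsub y hy (mem_ball_self hr))).1)
    · rw [Metric.tendstoUniformlyOn_iff]
      intro ε hε
      have hlim2 : Tendsto (fun n => ‖H n‖ * (4 * (‖v‖ / r) ^ 2)) atTop (𝓝 0) := by
        simpa using hHlim.mul_const (4 * (‖v‖ / r) ^ 2)
      filter_upwards [hev, hlim2.eventually (gt_mem_nhds hε)] with n hn hn2 y hy
      rw [dist_comm, dist_eq_norm]
      have ht := holo_taylor (f := f) (c := y) (r := r) (M := 2) hr
        (hf.mono (fun z hz => (hrU (hsub y hy hz)).1)) (by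
          intro z hz
          have h1 := (hrU (hsub y hy hz)).2
          have h2 := (hrU (hsub y hy (mem_ball_self hr))).2
          simp only [mem_setOf_eq] at h1 h2
          rw [← dist_eq_norm]
          linarith [dist_triangle_right (f z) (f y) (f x)]) (y + H n • v) (hmem y hy n hn)
      have h5 : (H n)⁻¹ • (f (y + H n • v) - f y) - fderiv ℂ f y v =
        (H n)⁻¹ • (f (y + H n • v) - f y - fderiv ℂ f y (y + H n • v - y)) := by
        rw [add_sub_cancel_left, map_smul, smul_sub (H n)⁻¹ (f (y + H n • v) - f y), smul_smul, inv_mul_cancel₀ (hH0 n), one_smul]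
      rw [h5, norm_smul, norm_inv]
      rw [add_sub_cancel_left] at ht ⊢
      rw [norm_smul] at ht
      have hp : 0 < ‖H n‖ := norm_pos_iff.2 (hH0 n)
      calc _ ≤ ‖H n‖⁻¹ * (2 * 2 * (‖H n‖ * ‖v‖ / r) ^ 2) := by gcongr
        _ = ‖H n‖ * (4 * (‖v‖ / r) ^ 2) := by field_simp; ring
        _ < ε := hn2
  exact (key.differentiableAt (ball_mem_nhds x hr)).differentiableWithinAt

lemma holo_contDiffOn {V W : Type} [NormedAddCommGroup V] [NormedSpace ℂ V] [FiniteDimensional ℂ V]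
    [NormedAddCommGroup W] [NormedSpace ℂ W] [CompleteSpace W]
    {f : V → W} {U : Set V} (hU : IsOpen U) (hf : DifferentiableOn ℂ f U) :
    ContDiffOn ℂ 1 f U := by
  have := (contDiffOn_succ_iff_fderiv_of_isOpen (𝕜 := ℂ) (n := 0) (f := f) hU).2
  rw [zero_add] at this
  refine this ⟨hf, by simp, ?_⟩
  rw [contDiffOn_clm_apply]
  intro v
  rw [contDiffOn_zero]
  exact (holo_fderiv_apply hU hf v).continuousOn

lemma holo_contDiffOn_nat {V W : Type} [NormedAddCommGroup V] [NormedSpace ℂ V]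
    [FiniteDimensional ℂ V]
    [NormedAddCommGroup W] [NormedSpace ℂ W] [CompleteSpace W] (n : ℕ)
    {f : V → W} {U : Set V} (hU : IsOpen U) (hf : DifferentiableOn ℂ f U) :
    ContDiffOn ℂ n f U := by
  induction n generalizing f with
  | zero => exact contDiffOn_zero.2 hf.continuousOn
  | succ n ih =>
    push_cast
    rw [contDiffOn_succ_iff_fderiv_of_isOpen hU]
    refine ⟨hf, by simp, ?_⟩
    rw [contDiffOn_clm_apply]
    intro v
    exact ih (holo_fderiv_apply hU hf v)

lemma holo_fderiv {V W : Type} [NormedAddCommGroup V] [NormedSpace ℂ V]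
    [FiniteDimensional ℂ V]
    [NormedAddCommGroup W] [NormedSpace ℂ W] [CompleteSpace W]
    {f : V → W} {U : Set V} (hU : IsOpen U) (hf : DifferentiableOn ℂ f U) :
    DifferentiableOn ℂ (fderiv ℂ f) U := by
  have h := holo_contDiffOn_nat 2 hU hf
  have h2 := ((contDiffOn_succ_iff_fderiv_of_isOpen (𝕜 := ℂ) (n := 1) (f := f) hU).1
    (by convert h using 1; norm_num)).2.2
  exact h2.differentiableOn (by simp)

open scoped Topology in
lemma straighten {V : Type} [NormedAddCommGroup V] [NormedSpace ℂ V] [FiniteDimensional ℂ V]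
    {K : V → ℂ} {U : Set V} (hU : IsOpen U) (hK : DifferentiableOn ℂ K U) {p : V} (hp : p ∈ U)
    {v : V} (hv : fderiv ℂ K p v ≠ 0) :
    ∃ σ : V → V, ∃ ρ > 0, DifferentiableOn ℂ σ (ball p ρ) ∧ InjOn σ (ball p ρ) ∧ σ p = p ∧
      HasFDerivAt σ (ContinuousLinearMap.id ℂ V) p ∧
      (∀ y ∈ ball p ρ, σ y ∈ U ∧ K (σ y) = K p + fderiv ℂ K p (y - p)) ∧
      ∃ N ∈ 𝓝 p, ∀ x ∈ N, ∀ ζ : ℂ, x + ζ • v ∈ N → K (x + ζ • v) = K x → ζ = 0 := by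
  have : CompleteSpace V := FiniteDimensional.complete ℂ V
  set c := fderiv ℂ K p v with hc
  set L := fderiv ℂ K p with hL
  let Θ : V → V := fun x => x + (K x - K p - L (x - p)) • (c⁻¹ • v)
  have hΘp : Θ p = p := by simp [Θ]
  have hΘC : ContDiffAt ℂ 1 Θ p := by
    have h1 : ContDiffAt ℂ 1 K p := (holo_contDiffOn hU hK).contDiffAt (hU.mem_nhds hp)
    fun_prop
  have hKd : HasFDerivAt K L p := (hK.differentiableAt (hU.mem_nhds hp)).hasFDerivAt
  have hΘd : HasFDerivAt Θ (((ContinuousLinearEquiv.refl ℂ V : V ≃L[ℂ] V)) : V →L[ℂ] V) p := by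
    have h1 : HasFDerivAt (fun x => L (x - p)) L p := by
      have := L.hasFDerivAt.comp p ((hasFDerivAt_id p).sub_const p)
      rwa [ContinuousLinearMap.comp_id] at this
    have h2 := (hasFDerivAt_id p).add (((hKd.sub_const (K p)).sub h1).smul_const (c⁻¹ • v))
    refine h2.congr_fderiv ?_
    ext x; simp
  let e := hΘC.toOpenPartialHomeomorph Θ hΘd one_ne_zero
  have hesrc : p ∈ e.source := hΘC.mem_toOpenPartialHomeomorph_source hΘd one_ne_zero
  have hetgt : p ∈ e.target := by
    have := hΘC.image_mem_toOpenPartialHomeomorph_target hΘd one_ne_zero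
    rwa [hΘp] at this
  have heq : ∀ x, e x = Θ x := fun x => rfl
  have hσp : e.symm p = p := by
    have := e.left_inv hesrc
    rwa [heq, hΘp] at this
  have hσC : ContDiffAt ℂ 1 e.symm p := by
    have := hΘC.to_localInverse hΘd one_ne_zero
    rwa [hΘp] at this
  have hLΘ : ∀ x, L (Θ x - p) = K x - K p := by
    intro x
    have : Θ x - p = (x - p) + (K x - K p - L (x - p)) • (c⁻¹ • v) := by simp only [Θ]; abel
    rw [this, map_add, map_smul, map_smul, ← hc]
    simp only [smul_eq_mul, inv_mul_cancel₀ hv]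
    ring
  have hev : ∀ᶠ y in 𝓝 p, y ∈ e.target ∧ DifferentiableAt ℂ e.symm y ∧ e.symm y ∈ U := by
    have e1 : ∀ᶠ y in 𝓝 p, y ∈ e.target := e.open_target.mem_nhds hetgt
    have e2 : ∀ᶠ y in 𝓝 p, ContDiffAt ℂ 1 e.symm y := hσC.eventually (by simp)
    have e3 : ∀ᶠ y in 𝓝 p, e.symm y ∈ U := by
      have h5 : U ∈ 𝓝 (e.symm p) := by
        rw [hσp]
        exact hU.mem_nhds hp
      exact hσC.continuousAt h5
    filter_upwards [e1, e2, e3] with y h1 h2 h3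
    exact ⟨h1, h2.differentiableAt (by simp), h3⟩
  obtain ⟨ρ, hρ, hball⟩ := Metric.eventually_nhds_iff_ball.1 hev
  refine ⟨e.symm, ρ, hρ, fun y hy => (hball y hy).2.1.differentiableWithinAt, ?_, hσp, ?_, ?_,
    e.source, e.open_source.mem_nhds hesrc, ?_⟩
  · exact e.symm.injOn.mono (fun y hy => (hball y hy).1)
  · have h3 := (hΘC.hasStrictFDerivAt' hΘd one_ne_zero).to_localInverse
    rw [hΘp] at h3
    exact h3.hasFDerivAt
  · intro y hy
    refine ⟨(hball y hy).2.2, ?_⟩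
    have h4 := hLΘ (e.symm y)
    rw [← heq, e.right_inv (hball y hy).1] at h4
    rw [h4]; ring
  · intro x hx ζ hxζ hKK
    have : Θ (x + ζ • v) = Θ x := by
      simp only [Θ, hKK]
      have : L (x + ζ • v - p) = L (x - p) + ζ * c := by
        rw [show x + ζ • v - p = (x - p) + ζ • v by abel, map_add, map_smul, smul_eq_mul]
      rw [this, smul_smul, smul_smul]
      have h6 : (K x - K p - (L (x - p) + ζ * c)) * c⁻¹ = (K x - K p - L (x - p)) * c⁻¹ - ζ := by
        field_simp; ring
      rw [h6, sub_smul]; abel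
    have h7 := e.injOn hxζ hx this
    have h8 : ζ • v = 0 := by simpa using h7
    rcases smul_eq_zero.1 h8 with h | h
    · exact h
    · exact absurd (by rw [hc, h, map_zero]) hv

open scoped Topology in
lemma hurwitz_zero {T : Type} [TopologicalSpace T] {φ : T → ℂ → ℂ} {t0 : T} {N : Set T}
    (hN : N ∈ 𝓝 t0) {r0 : ℝ} (hr0 : 0 < r0)
    (hc : ContinuousOn (Function.uncurry φ) (N ×ˢ ball 0 r0))
    (hd : ∀ t ∈ N, DifferentiableOn ℂ (φ t) (ball 0 r0))
    (h0 : φ t0 0 = 0) (hne : ¬ ∀ᶠ ζ in 𝓝 0, φ t0 ζ = 0) {r : ℝ} (hr : 0 < r) :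
    ∀ᶠ t in 𝓝 t0, ∃ ζ ∈ ball (0 : ℂ) r, φ t ζ = 0 := by
  have ht0 : t0 ∈ N := mem_of_mem_nhds hN
  have han : AnalyticAt ℂ (φ t0) 0 := (hd t0 ht0).analyticAt (ball_mem_nhds 0 hr0)
  have hpn := han.eventually_eq_zero_or_eventually_ne_zero.resolve_left hne
  rw [eventually_nhdsWithin_iff, Metric.eventually_nhds_iff_ball] at hpn
  obtain ⟨r2, hr2, hpn⟩ := hpn
  set r1 := min r (min r0 r2) / 2 with hr1
  have hmin : 0 < min r (min r0 r2) := by positivity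
  have hr1pos : 0 < r1 := by positivity
  have h1r : r1 < r := by have := min_le_left r (min r0 r2); linarith
  have h1r0 : r1 < r0 := by
    have := (min_le_right r (min r0 r2)).trans (min_le_left _ _); linarith
  have h1r2 : r1 < r2 := by
    have := (min_le_right r (min r0 r2)).trans (min_le_right _ _); linarith
  have hcb : closedBall (0 : ℂ) r1 ⊆ ball 0 r0 := closedBall_subset_ball h1r0
  have hsph : sphere (0 : ℂ) r1 ⊆ ball 0 r0 := sphere_subset_closedBall.trans hcb
  have hcS : IsCompact (sphere (0 : ℂ) r1) := isCompact_sphere 0 r1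
  have hSne : (sphere (0 : ℂ) r1).Nonempty := NormedSpace.sphere_nonempty.2 hr1pos.le
  obtain ⟨ζ0, hζ0, hζmin⟩ := hcS.exists_isMinOn hSne
    (((hd t0 ht0).continuousOn.mono hsph).norm)
  set m := ‖φ t0 ζ0‖ with hm
  have hmpos : 0 < m := by
    rw [hm, norm_pos_iff]
    apply hpn ζ0
    · exact closedBall_subset_ball h1r2 (sphere_subset_closedBall hζ0)
    · intro h; rw [mem_singleton_iff] at h; rw [h] at hζ0; simp at hζ0; linarith
  have hcAt : ∀ ζ ∈ ball (0 : ℂ) r0, ContinuousAt (Function.uncurry φ) (t0, ζ) := fun ζ hζ =>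
    hc.continuousAt (prod_mem_nhds hN (isOpen_ball.mem_nhds hζ))
  have hS : ∀ᶠ t in 𝓝 t0, ∀ ζ ∈ sphere (0 : ℂ) r1, m / 2 < ‖φ t ζ‖ := by
    have := hcS.eventually_forall_of_forall_eventually (x₀ := t0)
      (P := fun t ζ => m / 2 < ‖φ t ζ‖) (by
        intro ζ hζ
        have h1 : m / 2 < ‖Function.uncurry φ (t0, ζ)‖ := by
          have : m ≤ ‖φ t0 ζ‖ := hζmin hζ
          simp only [Function.uncurry]
          linarith
        exact (hcAt ζ (hsph hζ)).norm.eventually (lt_mem_nhds h1))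
    exact this
  have hC : ∀ᶠ t in 𝓝 t0, ‖φ t 0‖ < m / 2 := by
    have h1 : ContinuousAt (fun t => φ t 0) t0 :=
      ContinuousAt.comp (f := fun t : T => (t, (0 : ℂ))) (g := Function.uncurry φ)
        (hcAt 0 (mem_ball_self hr0)) (by fun_prop)
    have h2 : ‖φ t0 0‖ < m / 2 := by rw [h0, norm_zero]; positivity
    exact h1.norm.eventually (gt_mem_nhds h2)
  filter_upwards [hS, hC, hN] with t hS hC hN
  by_contra hcon
  push Not at hcon
  have hnz : ∀ ζ ∈ closedBall (0 : ℂ) r1, φ t ζ ≠ 0 := fun ζ hζ =>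
    hcon ζ (closedBall_subset_ball h1r hζ)
  have hdd : DifferentiableOn ℂ (fun ζ => (φ t ζ)⁻¹) (closedBall 0 r1) :=
    ((hd t hN).mono hcb).inv hnz
  have := Complex.norm_le_of_forall_mem_frontier_norm_le (f := fun ζ => (φ t ζ)⁻¹) (C := 2 / m)
    (U := ball (0 : ℂ) r1) isBounded_ball (hdd.diffContOnCl_ball subset_rfl) (by
      intro z hz
      have h1 := hS z (frontier_ball_subset_sphere hz)
      rw [norm_inv]
      rw [inv_le_comm₀ (by linarith) (by positivity)]
      rw [inv_div]; exact h1.le) (subset_closure (mem_ball_self hr1pos))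
  rw [norm_inv, inv_le_comm₀ (norm_pos_iff.2 (hnz 0 (by simp [hr1pos.le]))) (by positivity),
    inv_div] at this
  linarith

open scoped Topology in
lemma deriv_ne_zero_of_injOn {f : ℂ → ℂ} {U : Set ℂ} (hU : IsOpen U) (hf : DifferentiableOn ℂ f U)
    (hinj : InjOn f U) {a : ℂ} (ha : a ∈ U) : deriv f a ≠ 0 := by
  intro hda
  have hfa : AnalyticOnNhd ℂ f U := hf.analyticOnNhd hU
  have hf'a : AnalyticAt ℂ (deriv f) a := (hfa a ha).deriv
  rcases hf'a.eventually_eq_zero_or_eventually_ne_zero with h | h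
  · have h2 := h.and (hU.mem_nhds ha)
    obtain ⟨r, hr, hb⟩ := Metric.eventually_nhds_iff_ball.1 h2
    have hm : a + (r / 2 : ℝ) ∈ ball a r := by
      simp [mem_ball, dist_eq_norm]
      rw [abs_of_pos hr]; linarith
    have := hinj (hb _ hm).2 ha
      (isOpen_ball.is_const_of_deriv_eq_zero (convex_ball a r).isPreconnected
      (hf.mono (fun y hy => (hb y hy).2)) (fun y hy => (hb y hy).1) hm (mem_ball_self hr))
    simp at this
    linarith
  · rw [eventually_nhdsWithin_iff] at h
    have h2 := h.and (hU.mem_nhds ha)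
    obtain ⟨r, hr, hb⟩ := Metric.eventually_nhds_iff_ball.1 h2
    set B := ball a r with hB
    have hBU : B ⊆ U := fun y hy => (hb y hy).2
    have hopen : ∀ s ⊆ B, IsOpen s → IsOpen (f '' s) := by
      rcases (hfa.mono hBU).is_constant_or_isOpen (convex_ball a r).isPreconnected with h | h
      · exfalso
        obtain ⟨w, hw⟩ := h
        have hm : a + (r / 2 : ℝ) ∈ ball a r := by
          simp [mem_ball, dist_eq_norm]
          rw [abs_of_pos hr]; linarith
        have := hinj (hb _ hm).2 ha ((hw _ hm).trans (hw _ (mem_ball_self hr)).symm)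
        simp at this
        linarith
      · exact h
    let g := Function.invFunOn f B
    have hgf : ∀ z ∈ B, g (f z) = z := fun z hz => (hinj.mono hBU).leftInvOn_invFunOn hz
    have hgc : ∀ z ∈ B, ContinuousAt g (f z) := by
      intro z hz
      rw [ContinuousAt, hgf z hz]
      intro n hn
      obtain ⟨s, hs, hso, hzs⟩ := _root_.mem_nhds_iff.1 (inter_mem hn (isOpen_ball.mem_nhds hz))
      have := (hopen s (fun y hy => (hs hy).2) hso).mem_nhds (mem_image_of_mem f hzs)
      rw [mem_map]
      refine mem_of_superset this ?_
      rintro _ ⟨y, hy, rfl⟩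
      rw [mem_preimage, hgf y (hs hy).2]
      exact (hs hy).1
    have haB : a ∈ B := mem_ball_self hr
    have hD : IsOpen (f '' B) := hopen B subset_rfl isOpen_ball
    have hev : ∀ᶠ w in 𝓝[≠] (f a), DifferentiableAt ℂ g w := by
      rw [eventually_nhdsWithin_iff]
      filter_upwards [hD.mem_nhds (mem_image_of_mem f haB)] with w hw hwne
      obtain ⟨z, hz, rfl⟩ := hw
      have hza : z ≠ a := fun h => hwne (by rw [h]; rfl)
      have hfd : HasDerivAt f (deriv f z) (g (f z)) := by
        rw [hgf z hz]
        exact (hf.differentiableAt (hU.mem_nhds (hBU hz))).hasDerivAt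
      refine (HasDerivAt.of_local_left_inverse (hgc z hz) hfd ((hb z hz).1 hza) ?_).differentiableAt
      filter_upwards [hD.mem_nhds (mem_image_of_mem f hz)] with y hy
      exact Function.invFunOn_eq hy
    have hga := (Complex.analyticAt_of_differentiable_on_punctured_nhds_of_continuousAt hev
      (hgc a haB)).differentiableAt.hasDerivAt
    have hfa1 : HasDerivAt f (deriv f a) a := (hf.differentiableAt (hU.mem_nhds ha)).hasDerivAt
    have h3 := hga.comp a hfa1
    rw [hda, mul_zero] at h3
    have h4 : HasDerivAt (g ∘ f) 1 a := (hasDerivAt_id a).congr_of_eventuallyEq (by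
      filter_upwards [isOpen_ball.mem_nhds haB] with y hy
      exact hgf y hy)
    exact zero_ne_one (h3.unique h4)

/-- iterated directional derivative -/
def dirD {V : Type} [NormedAddCommGroup V] [NormedSpace ℂ V] (v : V) (J : V → ℂ) : ℕ → V → ℂ
  | 0 => J
  | n + 1 => fun x => fderiv ℂ (dirD v J n) x v

lemma dirD_diff {V : Type} [NormedAddCommGroup V] [NormedSpace ℂ V] (v : V) {J : V → ℂ}
    {U : Set V} (hU : IsOpen U) (hJ : DifferentiableOn ℂ J U) (n : ℕ) :
    DifferentiableOn ℂ (dirD v J n) U := by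
  induction n with
  | zero => exact hJ
  | succ n ih => exact holo_fderiv_apply hU ih v

open scoped Topology in
lemma iteratedDeriv_dirD {V : Type} [NormedAddCommGroup V] [NormedSpace ℂ V] (v : V) {J : V → ℂ}
    {U : Set V} (hU : IsOpen U) (hJ : DifferentiableOn ℂ J U) (a : V) (n : ℕ) :
    ∀ ζ : ℂ, a + ζ • v ∈ U → iteratedDeriv n (fun ζ : ℂ => J (a + ζ • v)) ζ =
      dirD v J n (a + ζ • v) := by
  induction n with
  | zero => intro ζ _; simp [dirD]
  | succ n ih =>
    intro ζ hζ
    rw [iteratedDeriv_succ]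
    have hev : iteratedDeriv n (fun ζ : ℂ => J (a + ζ • v)) =ᶠ[𝓝 ζ]
        fun ζ => dirD v J n (a + ζ • v) := by
      have : ContinuousAt (fun ζ : ℂ => a + ζ • v) ζ := by fun_prop
      filter_upwards [this (hU.mem_nhds hζ)] with ξ hξ
      exact ih ξ hξ
    rw [hev.deriv_eq]
    have h1 : HasFDerivAt (dirD v J n) (fderiv ℂ (dirD v J n) (a + ζ • v)) (a + ζ • v) :=
      ((dirD_diff v hU hJ n).differentiableAt (hU.mem_nhds hζ)).hasFDerivAt
    have h2 : HasDerivAt (fun ζ : ℂ => a + ζ • v) v ζ := by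
      simpa using ((hasDerivAt_id ζ).smul_const v).const_add a
    exact (h1.comp_hasDerivAt ζ h2).deriv

lemma zero_of_dirD {V : Type} [NormedAddCommGroup V] [NormedSpace ℂ V] {J : V → ℂ}
    {a : V} {r : ℝ} (hJ : DifferentiableOn ℂ J (ball a r))
    (h : ∀ v n, dirD v J n a = 0) : ∀ x ∈ ball a r, J x = 0 := by
  intro x hx
  set v := x - a with hv
  have hvr : ‖v‖ < r := by rw [hv, ← dist_eq_norm]; exact hx
  have hr : 0 < r := (norm_nonneg v).trans_lt hvr
  obtain ⟨R, hR1, hR⟩ : ∃ R : ℝ, 1 < R ∧ R * ‖v‖ < r := by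
    by_cases h0 : ‖v‖ = 0
    · exact ⟨2, by norm_num, by rw [h0]; simpa using hr⟩
    · have hp : 0 < ‖v‖ := lt_of_le_of_ne (norm_nonneg v) (Ne.symm h0)
      have : 1 < r / ‖v‖ := by rwa [one_lt_div hp]
      obtain ⟨R, h1, h2⟩ := exists_between this
      exact ⟨R, h1, by rwa [lt_div_iff₀ hp] at h2⟩
  have hmap : ∀ ζ ∈ ball (0 : ℂ) R, a + ζ • v ∈ ball a r := by
    intro ζ hζ
    simp only [mem_ball, dist_eq_norm, add_sub_cancel_left, norm_smul, sub_zero] at hζ ⊢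
    nlinarith [norm_nonneg v]
  have hd : DifferentiableOn ℂ (fun ζ : ℂ => J (a + ζ • v)) (ball 0 R) := by
    apply hJ.comp (Differentiable.differentiableOn (by fun_prop)) hmap
  have ht := Complex.taylorSeries_eq_on_ball (f := fun ζ : ℂ => J (a + ζ • v)) (c := 0) (r := R)
     hd (z := 1) (by simpa using hR1)
  have hx1 : a + (1 : ℂ) • v = x := by simp [hv]
  simp only [hx1] at ht
  rw [← ht]
  have : ∀ n, iteratedDeriv n (fun ζ : ℂ => J (a + ζ • v)) 0 = 0 := by
    intro n
    rw [iteratedDeriv_dirD v isOpen_ball hJ a n 0 (by simpa using hr)]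
    simpa using h v n
  simp [this]

def OsgoodAt (n : ℕ) : Prop := ∀ (V W : Type) [NormedAddCommGroup V] [NormedSpace ℂ V]
  [FiniteDimensional ℂ V] [NormedAddCommGroup W] [NormedSpace ℂ W] [FiniteDimensional ℂ W],
  Module.finrank ℂ V = n → Module.finrank ℂ W = n → ∀ (U : Set V) (f : V → W), IsOpen U →
  DifferentiableOn ℂ f U → InjOn f U → ∀ a ∈ U, Function.Injective (fderiv ℂ f a)

open scoped Topology in
lemma osgood_slice (n : ℕ) (ih : OsgoodAt n) (V W : Type) [NormedAddCommGroup V] [NormedSpace ℂ V]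
  [FiniteDimensional ℂ V] [NormedAddCommGroup W] [NormedSpace ℂ W] [FiniteDimensional ℂ W]
  (hV : Module.finrank ℂ V = n + 1) (hW : Module.finrank ℂ W = n + 1) (U : Set V) (f : V → W)
  (hU : IsOpen U) (hf : DifferentiableOn ℂ f U) (hinj : InjOn f U) (a : V) (ha : a ∈ U)
  (hA : fderiv ℂ f a ≠ 0) : Function.Injective (fderiv ℂ f a) := by
  have : CompleteSpace W := FiniteDimensional.complete ℂ W
  have : CompleteSpace V := FiniteDimensional.complete ℂ V
  set A := fderiv ℂ f a with hAdef
  obtain ⟨v0, hv0⟩ : ∃ v, A v ≠ 0 := by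
    by_contra h; push Not at h; exact hA (by ext v; simpa using h v)
  obtain ⟨l, -, hl⟩ := exists_dual_vector ℂ (A v0) (norm_ne_zero_iff.2 hv0)
  have hlv : l (A v0) ≠ 0 := by rw [hl]; simpa using hv0
  have hfd : HasFDerivAt f A a := (hf.differentiableAt (hU.mem_nhds ha)).hasFDerivAt
  let K : V → ℂ := fun x => l (f x)
  have hK : DifferentiableOn ℂ K U := l.differentiable.comp_differentiableOn hf
  have hKd : fderiv ℂ K a = l.comp A := (l.hasFDerivAt.comp a hfd).fderiv
  obtain ⟨σ, ρ, hρ, hσd, hσi, hσa, hσ', hσK, -⟩ := straighten hU hK ha (v := v0)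
    (by rw [hKd]; exact hlv)
  let P := (l.comp A : V →L[ℂ] ℂ).ker
  let Q := (l : W →L[ℂ] ℂ).ker
  have hl0 : (l : W →ₗ[ℂ] ℂ) ≠ 0 := by
    intro h
    exact hlv (by simpa using LinearMap.congr_fun h (A v0))
  have hlA0 : ((l.comp A : V →L[ℂ] ℂ) : V →ₗ[ℂ] ℂ) ≠ 0 := by
    intro h
    exact hlv (by simpa using LinearMap.congr_fun h v0)
  have hP : Module.finrank ℂ P = n := by
    have := Module.Dual.finrank_ker_add_one_of_ne_zero (f := ((l.comp A : V →L[ℂ] ℂ) : V →ₗ[ℂ] ℂ)) hlA0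
    rw [hV] at this
    exact Nat.succ_injective this
  have hQ : Module.finrank ℂ Q = n := by
    have := Module.Dual.finrank_ker_add_one_of_ne_zero (f := (l : W →ₗ[ℂ] ℂ)) hl0
    rw [hW] at this
    exact Nat.succ_injective this
  obtain ⟨π, hπ⟩ := Submodule.ClosedComplemented.of_finiteDimensional_quotient (𝕜 := ℂ)
    (Submodule.closed_of_finiteDimensional Q)
  let h : P → Q := fun x => π (f (σ (a + x)) - f a)
  have hval : ∀ x : P, (x : V) ∈ ball 0 ρ → f (σ (a + x)) - f a ∈ Q := by
    intro x hx
    have h1 := (hσK (a + x) (by simpa [mem_ball, dist_eq_norm] using hx)).2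
    rw [hKd, add_sub_cancel_left] at h1
    have h2 : (l.comp A) (x : V) = 0 := x.2
    rw [h2, add_zero] at h1
    change l (f (σ (a + x)) - f a) = 0
    rw [map_sub]
    exact sub_eq_zero.2 h1
  have hinner : DifferentiableOn ℂ (fun x : P => f (σ (a + x))) (ball 0 ρ) := by
    have h3 : MapsTo (fun x : P => a + (x : V)) (ball 0 ρ) (ball a ρ) := by
      intro x hx; simpa [mem_ball, dist_eq_norm] using hx
    have h4 : Differentiable ℂ (fun x : P => a + (x : V)) :=
      (P.subtypeL.differentiable).const_add a
    exact hf.comp (hσd.comp h4.differentiableOn h3) (fun x hx => (hσK _ (h3 hx)).1)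
  have hhd : DifferentiableOn ℂ h (ball 0 ρ) :=
    π.differentiable.comp_differentiableOn (hinner.sub_const (f a))
  have hhi : InjOn h (ball 0 ρ) := by
    intro x hx y hy hxy
    have hx' : (x : V) ∈ ball 0 ρ := by simpa using hx
    have hy' : (y : V) ∈ ball 0 ρ := by simpa using hy
    have h5 : h x = ⟨_, hval x hx'⟩ := hπ ⟨_, hval x hx'⟩
    have h6 : h y = ⟨_, hval y hy'⟩ := hπ ⟨_, hval y hy'⟩
    rw [h5, h6, Subtype.mk.injEq] at hxy
    have hbx : a + (x : V) ∈ ball a ρ := by simpa [mem_ball, dist_eq_norm] using hx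
    have hby : a + (y : V) ∈ ball a ρ := by simpa [mem_ball, dist_eq_norm] using hy
    have h7 := hσi hbx hby (hinj (hσK _ hbx).1 (hσK _ hby).1 (sub_left_injective hxy))
    exact Subtype.ext (add_left_cancel h7)
  have hmain := ih P Q hP hQ (ball 0 ρ) h isOpen_ball hhd hhi 0 (mem_ball_self hρ)
  have hder : HasFDerivAt h (π.comp (A.comp P.subtypeL)) 0 := by
    have h4 : HasFDerivAt (fun x : P => a + (x : V)) P.subtypeL 0 :=
      P.subtypeL.hasFDerivAt.const_add a
    have h8 : HasFDerivAt σ (ContinuousLinearMap.id ℂ V) (a + ((0 : P) : V)) := by simpa using hσ'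
    have h9 := h8.comp (0 : P) h4
    have h10 : HasFDerivAt f A ((σ ∘ fun x : P => a + (x : V)) 0) := by
      simpa [hσa] using hfd
    have h11 := (h10.comp (0 : P) h9).sub_const (f a)
    have := π.hasFDerivAt.comp (0 : P) h11
    exact this
  rw [hder.fderiv] at hmain
  rw [injective_iff_map_eq_zero]
  intro x hx
  have hxP : x ∈ P := by
    change l (A x) = 0
    rw [hx, map_zero]
  have := (injective_iff_map_eq_zero _).1 hmain ⟨x, hxP⟩ (by simp [hx])
  simpa using this

lemma const_of_fderiv_zero {V W : Type} [NormedAddCommGroup V] [NormedSpace ℂ V]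
    [NormedAddCommGroup W] [NormedSpace ℂ W] {f : V → W} {a : V} {r : ℝ}
    (hf : DifferentiableOn ℂ f (ball a r)) (h : ∀ x ∈ ball a r, fderiv ℂ f x = 0)
    {x y : V} (hx : x ∈ ball a r) (hy : y ∈ ball a r) : f x = f y := by
  let : NormedSpace ℝ V := NormedSpace.restrictScalars ℝ ℂ V
  refine (convex_ball a r).is_const_of_fderivWithin_eq_zero hf (fun z hz => ?_) hx hy
  rw [fderivWithin_of_isOpen isOpen_ball hz, h z hz]

lemma diffOn_prod {V ι : Type} [NormedAddCommGroup V] [NormedSpace ℂ V] {f : ι → V → ℂ}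
    {U : Set V} (s : Finset ι) (h : ∀ i, DifferentiableOn ℂ (f i) U) :
    DifferentiableOn ℂ (fun x => ∏ i ∈ s, f i x) U := by
  classical
  induction s using Finset.induction_on with
  | empty => simp
  | insert a s ha ih =>
    simp only [Finset.prod_insert ha]
    exact (h a).mul ih

/-- the jacobian-like function -/
lemma exists_jac {V W : Type} [NormedAddCommGroup V] [NormedSpace ℂ V]
    [FiniteDimensional ℂ V] [NormedAddCommGroup W] [NormedSpace ℂ W] [FiniteDimensional ℂ W]
    (h : Module.finrank ℂ V = Module.finrank ℂ W) {f : V → W} {U : Set V} (hU : IsOpen U)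
    (hf : DifferentiableOn ℂ f U) : ∃ J : V → ℂ, DifferentiableOn ℂ J U ∧
      ∀ x, J x = 0 ↔ ¬ Function.Injective (fderiv ℂ f x) := by
  have : CompleteSpace W := FiniteDimensional.complete ℂ W
  let e : W ≃L[ℂ] V := ContinuousLinearEquiv.ofFinrankEq h.symm
  let b := Module.finBasis ℂ V
  let T : V → (V →ₗ[ℂ] V) := fun x => (e : W →L[ℂ] V).comp (fderiv ℂ f x)
  refine ⟨fun x => (LinearMap.toMatrix b b (T x)).det, ?_, ?_⟩
  · simp only [Matrix.det_apply]
    refine DifferentiableOn.fun_sum (fun σ _ => ?_)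
    refine DifferentiableOn.const_smul ?_ _
    refine diffOn_prod _ (fun i => ?_)
    simp only [LinearMap.toMatrix_apply]
    have h1 : DifferentiableOn ℂ (fun x => fderiv ℂ f x (b i)) U := holo_fderiv_apply hU hf _
    let l : W →ₗ[ℂ] ℂ := (b.coord (σ i)).comp (e : W →ₗ[ℂ] V)
    exact (LinearMap.toContinuousLinearMap l).differentiable.comp_differentiableOn h1
  · intro x
    simp only [LinearMap.det_toMatrix]
    rw [LinearMap.det_eq_zero_iff_ker_ne_bot, not_iff_not, LinearMap.ker_eq_bot]
    have : (⇑(T x) : V → V) = e ∘ (fderiv ℂ f x) := rfl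
    rw [this]
    exact e.injective.of_comp_iff _

open scoped Topology in
lemma osgood_zero : OsgoodAt 0 := by
  intro V W _ _ _ _ _ _ hV hW U f hU hf hinj a ha x y _
  have := Module.finrank_zero_iff.1 hV
  exact Subsingleton.elim _ _

open scoped Topology in
lemma osgood_one : OsgoodAt 1 := by
  intro V W _ _ _ _ _ _ hV hW U f hU hf hinj a ha
  let e : ℂ ≃L[ℂ] V := ContinuousLinearEquiv.ofFinrankEq (by simp [hV])
  let e' : W ≃L[ℂ] ℂ := ContinuousLinearEquiv.ofFinrankEq (by simp [hW])
  have hd := deriv_ne_zero_of_injOn (f := fun z => e' (f (e z))) (U := e ⁻¹' U) (a := e.symm a)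
    (hU.preimage e.continuous)
    (e'.differentiable.comp_differentiableOn
      (hf.comp e.differentiable.differentiableOn (fun x hx => hx)))
    (fun x hx y hy hxy => e.injective (hinj hx hy (e'.injective hxy))) (by simpa using ha)
  have hfd : HasFDerivAt f (fderiv ℂ f a) (e (e.symm a)) := by
    rw [e.apply_symm_apply]; exact (hf.differentiableAt (hU.mem_nhds ha)).hasFDerivAt
  have h1 : HasDerivAt (fun z => e' (f (e z))) (e' (fderiv ℂ f a (e 1))) (e.symm a) := by
    have h2 : HasDerivAt (fun z => e z) (e 1) (e.symm a) := (e : ℂ →L[ℂ] V).hasDerivAt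
    have h3 := hfd.comp_hasDerivAt _ h2
    exact (e' : W →L[ℂ] ℂ).hasFDerivAt.comp_hasDerivAt (e.symm a) h3
  rw [h1.deriv] at hd
  rw [injective_iff_map_eq_zero]
  intro x hx
  have hx1 : x = (e.symm x) • e 1 := by
    rw [← map_smul]; simp
  rw [hx1, map_smul, smul_eq_zero] at hx
  rcases hx with hx | hx
  · simpa using hx
  · exact absurd (by rw [hx]; simp) hd

open scoped Topology in
lemma osgood_step (n : ℕ) (hn : 1 ≤ n) (ih : OsgoodAt n) : OsgoodAt (n + 1) := by
  intro V W _ _ _ _ _ _ hV hW U f hU hf hinj a ha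
  have : CompleteSpace V := FiniteDimensional.complete ℂ V
  by_contra hA
  obtain ⟨J, hJd, hJ⟩ := exists_jac (hV.trans hW.symm) hU hf
  have hZ : ∀ p ∈ U, J p = 0 → fderiv ℂ f p = 0 := by
    intro p hp h
    by_contra h2
    exact (hJ p).1 h (osgood_slice n ih V W hV hW U f hU hf hinj p hp h2)
  have hJa : J a = 0 := (hJ a).2 hA
  have : Nontrivial V := Module.nontrivial_of_finrank_pos (R := ℂ) (by omega)
  have hex : ∃ m, ∃ p ∈ U, J p = 0 ∧ ∃ v, dirD v J m p ≠ 0 := by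
    by_contra hcon
    push Not at hcon
    obtain ⟨r, hr, hrU⟩ := Metric.isOpen_iff.1 hU a ha
    have h0 := zero_of_dirD (hJd.mono hrU) (fun v n => hcon n a ha hJa v)
    obtain ⟨w, hw⟩ := exists_ne (0 : V)
    obtain ⟨c, hc0, hc⟩ : ∃ c : V, c ≠ 0 ∧ a + c ∈ ball a r := by
      refine ⟨((r / 2 / ‖w‖ : ℝ) : ℂ) • w, ?_, ?_⟩
      · have := norm_pos_iff.2 hw
        refine smul_ne_zero ?_ hw
        exact_mod_cast (by positivity : (r / 2 / ‖w‖ : ℝ) ≠ 0)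
      · have := norm_pos_iff.2 hw
        simp only [mem_ball, dist_eq_norm, add_sub_cancel_left, norm_smul, Complex.norm_real]
        rw [Real.norm_of_nonneg (by positivity)]
        field_simp; linarith
    have := const_of_fderiv_zero (hf.mono hrU) (fun x hx => hZ x (hrU hx) (h0 x hx)) hc
      (mem_ball_self hr)
    have := hinj (hrU hc) ha this
    simp [hc0] at this
  classical
  obtain ⟨p, hp, hJp, v, hv⟩ := Nat.find_spec hex
  have hmin : ∀ m, m < Nat.find hex → ∀ p ∈ U, J p = 0 → ∀ v, dirD v J m p = 0 := by
    intro m hm p hp hJp v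
    by_contra h
    exact Nat.find_min hex hm ⟨p, hp, hJp, v, h⟩
  obtain ⟨m, hm⟩ : ∃ m, Nat.find hex = m + 1 := by
    refine Nat.exists_eq_succ_of_ne_zero ?_
    intro h
    rw [h] at hv
    exact hv hJp
  rw [hm] at hv hmin
  let K := dirD v J m
  have hKZ : ∀ q ∈ U, J q = 0 → K q = 0 := fun q hq h => hmin m (Nat.lt_succ_self m) q hq h v
  have hKd : DifferentiableOn ℂ K U := dirD_diff v hU hJd m
  have hKv : fderiv ℂ K p v ≠ 0 := hv
  obtain ⟨σ, ρ, hρ, hσd, hσi, hσa, hσ', hσK, N, hN, hNv⟩ := straighten hU hKd hp hKv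
  -- w in the kernel
  obtain ⟨w, hw0, hw⟩ : ∃ w : V, w ≠ 0 ∧ fderiv ℂ K p w = 0 := by
    have h1 : ¬ Function.Injective ((fderiv ℂ K p : V →L[ℂ] ℂ) : V →ₗ[ℂ] ℂ) := by
      intro h
      have := LinearMap.finrank_le_finrank_of_injective h
      rw [hV] at this
      simp at this
      omega
    rw [injective_iff_map_eq_zero] at h1
    push Not at h1
    obtain ⟨w, h1, h2⟩ := h1
    exact ⟨w, h2, h1⟩
  have hv0 : v ≠ 0 := by rintro rfl; simp at hKv
  let γ : ℂ → V := fun t => σ (p + t • w)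
  have hlin : Continuous (fun t : ℂ => p + t • w) := by fun_prop
  have hopenT : IsOpen ((fun t : ℂ => p + t • w) ⁻¹' ball p ρ) := isOpen_ball.preimage hlin
  obtain ⟨t0, ht0, ht0b⟩ := Metric.isOpen_iff.1 hopenT 0 (by simpa using hρ)
  have hγd : DifferentiableOn ℂ γ (ball 0 t0) :=
    hσd.comp (Differentiable.differentiableOn (by fun_prop)) (fun t ht => ht0b ht)
  have hγ0 : γ 0 = p := by simp [γ, hσa]
  have hγU : ∀ t ∈ ball (0 : ℂ) t0, γ t ∈ U := fun t ht => (hσK _ (ht0b ht)).1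
  have hγK : ∀ t ∈ ball (0 : ℂ) t0, K (γ t) = 0 := by
    intro t ht
    have := (hσK _ (ht0b ht)).2
    simp only [add_sub_cancel_left, map_smul, hw, smul_zero, add_zero] at this
    rw [← hKZ p hp hJp]; exact this
  have hγi : InjOn γ (ball 0 t0) := by
    intro s hs t ht hst
    have := hσi (ht0b hs) (ht0b ht) hst
    have := add_left_cancel this
    exact smul_left_injective ℂ hw0 this
  -- nbhd where γ t + ζ v stays in U ∩ N
  have hγc : ContinuousAt γ 0 := (hγd.differentiableAt (ball_mem_nhds 0 ht0)).continuousAt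
  have hcont : ContinuousAt (fun q : ℂ × ℂ => γ q.1 + q.2 • v) (0, 0) := by
    have : ContinuousAt (fun q : ℂ × ℂ => γ q.1) (0, 0) :=
      ContinuousAt.comp (f := Prod.fst) (g := γ) (x := ((0 : ℂ), (0 : ℂ))) hγc continuousAt_fst
    exact this.add (by fun_prop)
  have hmem : (U ∩ N) ∈ 𝓝 ((fun q : ℂ × ℂ => γ q.1 + q.2 • v) (0, 0)) := by
    simp only [hγ0, zero_smul, add_zero]
    exact inter_mem (hU.mem_nhds hp) hN
  have hev := hcont hmem
  rw [mem_map, Metric.mem_nhds_iff] at hev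
  obtain ⟨r1, hr1, hb1⟩ := hev
  set r0 := min r1 t0 with hr0def
  have hr0 : 0 < r0 := lt_min hr1 ht0
  have hstay : ∀ t ∈ ball (0 : ℂ) r0, ∀ ζ ∈ ball (0 : ℂ) r0, γ t + ζ • v ∈ U ∩ N := by
    intro t ht ζ hζ
    have : (t, ζ) ∈ ball ((0 : ℂ), (0 : ℂ)) r1 := by
      rw [mem_ball, Prod.dist_eq]
      exact max_lt (lt_of_lt_of_le ht (min_le_left _ _)) (lt_of_lt_of_le hζ (min_le_left _ _))
    exact hb1 this
  have hsub : ball (0 : ℂ) r0 ⊆ ball 0 t0 := ball_subset_ball (min_le_right _ _)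
  have hz := hurwitz_zero (φ := fun t ζ => J (γ t + ζ • v)) (t0 := (0 : ℂ)) (N := ball 0 r0)
    (ball_mem_nhds 0 hr0) hr0 (by
      refine hJd.continuousOn.comp (f := fun q : ℂ × ℂ => γ q.1 + q.2 • v) ?_ ?_
      · refine ContinuousOn.add ?_ (by fun_prop)
        exact (hγd.continuousOn.mono hsub).comp continuous_fst.continuousOn (fun q hq => hq.1)
      · exact fun q hq => (hstay q.1 hq.1 q.2 hq.2).1)
    (by
      intro t ht
      exact hJd.comp (Differentiable.differentiableOn (by fun_prop))
        (fun ζ hζ => (hstay t ht ζ hζ).1))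
    (by simp [hγ0, hJp])
    (by
      simp only [hγ0]
      intro h
      have h1 := iteratedDeriv_dirD v hU hJd p (m + 1) 0 (by simpa using hp)
      have h2 : (fun ζ : ℂ => J (p + ζ • v)) =ᶠ[𝓝 0] fun _ => 0 := h
      rw [h2.iteratedDeriv_eq] at h1
      simp at h1
      exact hv h1.symm) hr0
  rw [Metric.eventually_nhds_iff_ball] at hz
  obtain ⟨r2, hr2, hz⟩ := hz
  set s := min r2 r0
  have hs : 0 < s := lt_min hr2 hr0
  have hs0 : ball (0 : ℂ) s ⊆ ball 0 r0 := ball_subset_ball (min_le_right _ _)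
  have hγZ : ∀ t ∈ ball (0 : ℂ) s, J (γ t) = 0 := by
    intro t ht
    obtain ⟨ζ, hζ, hJζ⟩ := hz t (ball_subset_ball (min_le_left _ _) ht)
    have h1 := hstay t (hs0 ht) ζ hζ
    have h2 := hstay t (hs0 ht) 0 (mem_ball_self hr0)
    rw [zero_smul, add_zero] at h2
    have h3 : ζ = 0 := hNv _ h2.2 ζ h1.2 (by
      have e1 : K (γ t + ζ • v) = 0 := hKZ _ h1.1 hJζ
      have e2 : K (γ t) = 0 := hγK t (hsub (hs0 ht))
      exact e1.trans e2.symm)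
    simpa [h3] using hJζ
  have hcomp : ∀ t ∈ ball (0 : ℂ) s, HasFDerivAt (fun t => f (γ t)) (0 : ℂ →L[ℂ] W) t := by
    intro t ht
    have h1 : HasFDerivAt f (fderiv ℂ f (γ t)) (γ t) :=
      (hf.differentiableAt (hU.mem_nhds (hγU t (hsub (hs0 ht))))).hasFDerivAt
    rw [hZ _ (hγU t (hsub (hs0 ht))) (hγZ t ht)] at h1
    have h2 := (hγd.differentiableAt (isOpen_ball.mem_nhds (hsub (hs0 ht)))).hasFDerivAt
    have h3 := h1.comp t h2
    rw [ContinuousLinearMap.zero_comp] at h3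
    exact h3
  have hhalf : ((s / 2 : ℝ) : ℂ) ∈ ball (0 : ℂ) s := by
    simp only [mem_ball, dist_zero_right, Complex.norm_real]
    rw [Real.norm_of_nonneg (by positivity)]; linarith
  have hc := const_of_fderiv_zero (f := fun t => f (γ t))
    (fun t ht => (hcomp t ht).differentiableAt.differentiableWithinAt)
    (fun t ht => (hcomp t ht).fderiv) hhalf (mem_ball_self hs)
  have h4 := hγi (hsub (hs0 hhalf)) (hsub (hs0 (mem_ball_self hs)))
    (hinj (hγU _ (hsub (hs0 hhalf))) (hγU _ (hsub (hs0 (mem_ball_self hs)))) hc)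
  have : s / 2 = 0 := by exact_mod_cast h4
  linarith

lemma osgood (n : ℕ) : OsgoodAt n := by
  induction n with
  | zero => exact osgood_zero
  | succ n ih =>
    rcases Nat.eq_zero_or_pos n with rfl | h
    · exact osgood_one
    · exact osgood_step n h ih

open scoped Topology in
/-- The inverse of an injective entire map is holomorphic on the (open) range. -/
lemma inverse_holo {V : Type} [NormedAddCommGroup V] [NormedSpace ℂ V]
    [FiniteDimensional ℂ V] {f : V → V} (hf : Differentiable ℂ f) (hinj : Function.Injective f) :
    DifferentiableOn ℂ (Function.invFun f) (range f) := by
  have : CompleteSpace V := FiniteDimensional.complete ℂ V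
  rintro _ ⟨x, rfl⟩
  have h1 := osgood _ V V rfl rfl univ f isOpen_univ hf.differentiableOn hinj.injOn x (mem_univ x)
  let e : V ≃L[ℂ] V := (LinearEquiv.ofInjectiveEndo (fderiv ℂ f x : V →ₗ[ℂ] V)
    h1).toContinuousLinearEquiv
  have he : (e : V →L[ℂ] V) = fderiv ℂ f x := by ext v; rfl
  have hC : ContDiffAt ℂ 1 f x :=
    (holo_contDiffOn isOpen_univ hf.differentiableOn).contDiffAt univ_mem
  have hstr : HasStrictFDerivAt f (e : V →L[ℂ] V) x := by
    rw [he]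
    exact hC.hasStrictFDerivAt (by simp)
  have h2 := hstr.to_localInverse
  have h3 := hstr.eventually_right_inverse
  have h4 : hstr.localInverse f e x =ᶠ[𝓝 (f x)] Function.invFun f := by
    filter_upwards [h3] with y hy
    apply hinj
    rw [hy, Function.invFun_eq ⟨_, hy⟩]
  exact (h2.hasFDerivAt.congr_of_eventuallyEq h4.symm).differentiableAt.differentiableWithinAt

/-- Complex Euclidean space. -/
abbrev EC (k : ℕ) := EuclideanSpace ℂ (Fin k)

/-- A bijection which is an automorphism. -/
def IsAut {k : ℕ} (Ψ : EC k ≃ EC k) : Prop := Differentiable ℂ Ψ ∧ Differentiable ℂ Ψ.symm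

lemma IsAut.trans {k : ℕ} {A B : EC k ≃ EC k} (hA : IsAut A) (hB : IsAut B) :
    IsAut (A.trans B) := ⟨hB.1.comp hA.1, hA.2.comp hB.2⟩

lemma IsAut.symm {k : ℕ} {A : EC k ≃ EC k} (hA : IsAut A) : IsAut A.symm := ⟨hA.2, hA.1⟩

lemma isAut_refl (k : ℕ) : IsAut (Equiv.refl (EC k)) := ⟨differentiable_id, differentiable_id⟩

/-- First order approximation of a flow. -/
def Apx {k : ℕ} (V : EC k → EC k) (h : ℂ) (ε R : ℝ) (A : EC k → EC k) : Prop :=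
  ∀ z ∈ closedBall 0 R, ‖A z - z - h • V z‖ ≤ ε * ‖h‖

lemma cont_bdd {k : ℕ} {F : Type} [NormedAddCommGroup F] {V : EC k → F} (hV : Continuous V)
    (R : ℝ) : ∃ M > 0, ∀ z ∈ closedBall (0 : EC k) R, ‖V z‖ ≤ M := by
  obtain ⟨M, hM⟩ := (isCompact_closedBall (0 : EC k) R).exists_bound_of_continuousOn hV.continuousOn
  exact ⟨max M 1, by positivity, fun z hz => (hM z hz).trans (le_max_left _ _)⟩

lemma cont_unif {k : ℕ} {V : EC k → EC k} (hV : Continuous V) (R : ℝ) {ε : ℝ} (hε : 0 < ε) :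
    ∃ δ > 0, ∀ z ∈ closedBall (0 : EC k) R, ∀ w ∈ closedBall (0 : EC k) R, ‖z - w‖ < δ →
      ‖V z - V w‖ < ε := by
  have h := (isCompact_closedBall (0 : EC k) R).uniformContinuousOn_of_continuous hV.continuousOn
  rw [Metric.uniformContinuousOn_iff] at h
  obtain ⟨δ, hδ, h⟩ := h ε hε
  refine ⟨δ, hδ, fun z hz w hw hzw => ?_⟩
  rw [← dist_eq_norm]
  exact h z hz w hw (by rwa [dist_eq_norm])

lemma apx_comp {k : ℕ} {V1 V2 : EC k → EC k} (h1 : Continuous V1) (h2 : Continuous V2)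
    (R : ℝ) {ε : ℝ} (hε : 0 < ε) : ∃ h0 > 0, ∃ ε' > 0, ∀ h : ℂ, ‖h‖ < h0 →
    ∀ A B : EC k → EC k, Apx V1 h ε' (R + 1) A → Apx V2 h ε' (R + 1) B →
      Apx (V1 + V2) h ε R (A ∘ B) := by
  obtain ⟨M, hM0, hM⟩ := cont_bdd h2 R
  obtain ⟨δ, hδ, hunif⟩ := cont_unif h1 (R + 1) (ε := ε / 3) (by positivity)
  refine ⟨min 1 δ / (M + ε), by positivity, ε / 3, by positivity, ?_⟩
  intro h hh A B hA hB z hz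
  have hz1 : z ∈ closedBall (0 : EC k) (R + 1) := closedBall_subset_closedBall (by linarith) hz
  have hb := hB z hz1
  have hdist : ‖B z - z‖ ≤ ‖h‖ * (M + ε) := by
    have : B z - z = (B z - z - h • V2 z) + h • V2 z := by abel
    rw [this]
    refine (norm_add_le _ _).trans ?_
    rw [norm_smul]
    have := mul_le_mul_of_nonneg_left (hM z hz) (norm_nonneg h)
    nlinarith [norm_nonneg h]
  have hlt : ‖B z - z‖ < min 1 δ := by
    rw [lt_div_iff₀ (by positivity)] at hh
    exact hdist.trans_lt hh
  have hBz : B z ∈ closedBall (0 : EC k) (R + 1) := by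
    rw [mem_closedBall, dist_zero_right] at hz ⊢
    have : B z = (B z - z) + z := by abel
    rw [this]
    refine (norm_add_le _ _).trans ?_
    have := hlt.le.trans (min_le_left 1 δ)
    linarith
  have ha := hA _ hBz
  have hV := (hunif _ hBz _ hz1 (hlt.trans_le (min_le_right _ _))).le
  have : (A ∘ B) z - z - h • (V1 + V2) z =
      (A (B z) - B z - h • V1 (B z)) + (B z - z - h • V2 z) + h • (V1 (B z) - V1 z) := by
    simp only [Function.comp, Pi.add_apply, smul_add, smul_sub]; abel
  rw [this]
  refine (norm_add₃_le).trans ?_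
  rw [norm_smul]
  have := mul_le_mul_of_nonneg_left hV (norm_nonneg h)
  linarith

/-- Fields which can be approximately integrated by automorphisms. -/
def FlowField {k : ℕ} (V : EC k → EC k) : Prop :=
  Continuous V ∧ ∀ R : ℝ, ∀ ε > (0 : ℝ), ∃ h0 > (0 : ℝ), ∀ h : ℂ, ‖h‖ < h0 →
    ∃ Ψ : EC k ≃ EC k, IsAut Ψ ∧ Apx V h ε R Ψ ∧ Apx V (-h) ε R Ψ.symm

lemma FlowField.add {k : ℕ} {V1 V2 : EC k → EC k} (h1 : FlowField V1) (h2 : FlowField V2) :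
    FlowField (V1 + V2) := by
  refine ⟨h1.1.add h2.1, fun R ε hε => ?_⟩
  obtain ⟨a, ha, ε1, hε1, hc1⟩ := apx_comp h1.1 h2.1 R hε
  obtain ⟨b, hb, ε2, hε2, hc2⟩ := apx_comp h2.1 h1.1 R hε
  have hm : 0 < min ε1 ε2 := lt_min hε1 hε2
  obtain ⟨c, hc, hF1⟩ := h1.2 (R + 1) (min ε1 ε2) hm
  obtain ⟨d, hd, hF2⟩ := h2.2 (R + 1) (min ε1 ε2) hm
  refine ⟨min (min a b) (min c d), by positivity, fun h hh => ?_⟩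
  simp only [lt_min_iff] at hh
  obtain ⟨Ψ1, hΨ1, p1, q1⟩ := hF1 h hh.2.1
  obtain ⟨Ψ2, hΨ2, p2, q2⟩ := hF2 h hh.2.2
  have mono : ∀ {V : EC k → EC k} {h : ℂ} {e e' : ℝ} {A : EC k → EC k}, e ≤ e' →
      Apx V h e (R + 1) A → Apx V h e' (R + 1) A := fun he hA z hz =>
    (hA z hz).trans (mul_le_mul_of_nonneg_right he (norm_nonneg _))
  refine ⟨Ψ2.trans Ψ1, hΨ2.trans hΨ1, ?_, ?_⟩
  · exact hc1 h hh.1.1 Ψ1 Ψ2 (mono (min_le_left _ _) p1) (mono (min_le_left _ _) p2)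
  · have := hc2 (-h) (by simpa using hh.1.2) Ψ2.symm Ψ1.symm (mono (min_le_right _ _) q2)
      (mono (min_le_right _ _) q1)
    rw [add_comm V1 V2]
    exact this

lemma FlowField.smul {k : ℕ} {V : EC k → EC k} (hV : FlowField V) (c : ℂ) :
    FlowField (c • V) := by
  refine ⟨hV.1.const_smul c, fun R ε hε => ?_⟩
  have hc : 0 < ‖c‖ + 1 := by positivity
  obtain ⟨h0, hh0, hF⟩ := hV.2 R (ε / (‖c‖ + 1)) (by positivity)
  refine ⟨h0 / (‖c‖ + 1), by positivity, fun h hh => ?_⟩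
  rw [lt_div_iff₀ hc] at hh
  obtain ⟨Ψ, hΨ, p, q⟩ := hF (h * c) (by
    rw [norm_mul]; nlinarith [norm_nonneg h])
  have hle : ε / (‖c‖ + 1) * (‖h‖ * ‖c‖) ≤ ε * ‖h‖ := by
    rw [div_mul_eq_mul_div, div_le_iff₀ hc]
    nlinarith [mul_nonneg hε.le (norm_nonneg h)]
  refine ⟨Ψ, hΨ, ?_, ?_⟩
  · intro z hz
    have := p z hz
    rw [norm_mul, mul_smul] at this
    exact this.trans hle
  · intro z hz
    have := q z hz
    rw [norm_neg, norm_mul, ← neg_mul, mul_smul] at this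
    rw [norm_neg]
    exact this.trans hle

lemma shear_field {k : ℕ} {f : EC k → ℂ} (hf : Differentiable ℂ f) (v : EC k)
    (hv : ∀ z, ∀ c : ℂ, f (z + c • v) = f z) : FlowField (fun z => f z • v) := by
  refine ⟨by have := hf.continuous; fun_prop, fun R ε hε => ⟨1, one_pos, fun h _ => ?_⟩⟩
  refine ⟨⟨fun z => z + (h * f z) • v, fun z => z + (-h * f z) • v, fun z => ?_, fun z => ?_⟩,
    ⟨?_, ?_⟩, ?_, ?_⟩
  · simp only [hv]; rw [add_assoc, ← add_smul]; simp
  · simp only [hv]; rw [add_assoc, ← add_smul]; simp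
  · change Differentiable ℂ (fun z => z + (h * f z) • v); fun_prop
  · change Differentiable ℂ (fun z => z + (-h * f z) • v); fun_prop
  · intro z hz
    simp only [Equiv.coe_fn_mk, mul_smul, add_sub_cancel_left, sub_self, norm_zero]; positivity
  · intro z hz
    simp only [Equiv.coe_fn_symm_mk, mul_smul, add_sub_cancel_left, sub_self, norm_zero]; positivity

lemma overshear_apx {k : ℕ} {f : EC k → ℂ} (hf : Continuous f) (v : EC k)
    (l : EC k →L[ℂ] ℂ) (R : ℝ) {ε : ℝ} (hε : 0 < ε) : ∃ h0 > 0, ∀ h : ℂ, ‖h‖ < h0 →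
    Apx (fun z => (f z * l z) • v) h ε R (fun z => z + ((Complex.exp (h * f z) - 1) * l z) • v) := by
  obtain ⟨M, hM0, hM⟩ := cont_bdd hf R
  obtain ⟨L, hL0, hL⟩ := cont_bdd l.continuous R
  refine ⟨min (1 / M) (ε / (M ^ 2 * L * (‖v‖ + 1))), by positivity, fun h hh z hz => ?_⟩
  rw [lt_min_iff, lt_div_iff₀ hM0, lt_div_iff₀ (by positivity)] at hh
  have hle : ‖h * f z‖ ≤ ‖h‖ * M := by
    rw [norm_mul]; exact mul_le_mul_of_nonneg_left (hM z hz) (norm_nonneg h)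
  have he := Complex.norm_exp_sub_one_sub_id_le (x := h * f z) (hle.trans hh.1.le)
  have : z + ((Complex.exp (h * f z) - 1) * l z) • v - z - h • (f z * l z) • v =
      ((Complex.exp (h * f z) - 1 - h * f z) * l z) • v := by
    rw [add_sub_cancel_left, smul_smul, ← sub_smul]; ring_nf
  rw [this, norm_smul, norm_mul]
  have h3 : ‖h * f z‖ ^ 2 ≤ (‖h‖ * M) ^ 2 := pow_le_pow_left₀ (norm_nonneg _) hle 2
  calc _ ≤ (‖h‖ * M) ^ 2 * L * (‖v‖ + 1) := by
        gcongr
        · exact he.trans h3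
        · exact hL z hz
        · linarith
    _ = ‖h‖ * (‖h‖ * (M ^ 2 * L * (‖v‖ + 1))) := by ring
    _ ≤ ‖h‖ * ε := by gcongr; exact hh.2.le
    _ = _ := mul_comm _ _

lemma overshear_field {k : ℕ} {f : EC k → ℂ} (hf : Differentiable ℂ f) (v : EC k)
    (l : EC k →L[ℂ] ℂ) (hl : l v = 1)
    (hv : ∀ z, ∀ c : ℂ, f (z + c • v) = f z) : FlowField (fun z => (f z * l z) • v) := by
  refine ⟨by have := hf.continuous; fun_prop, fun R ε hε => ?_⟩
  obtain ⟨h0, hh0, hA⟩ := overshear_apx hf.continuous v l R hε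
  refine ⟨h0, hh0, fun h hh => ?_⟩
  have key : ∀ h : ℂ, ∀ z, (z + ((Complex.exp (h * f z) - 1) * l z) • v) +
      ((Complex.exp (-h * f (z + ((Complex.exp (h * f z) - 1) * l z) • v)) - 1) *
      l (z + ((Complex.exp (h * f z) - 1) * l z) • v)) • v = z := by
    intro h z
    rw [hv, map_add, map_smul, hl, add_assoc, ← add_smul]
    have : (Complex.exp (h * f z) - 1) * l z +
      (Complex.exp (-h * f z) - 1) * (l z + ((Complex.exp (h * f z) - 1) * l z) • 1) = 0 := by
      have h2 : Complex.exp (-h * f z) * Complex.exp (h * f z) = 1 := by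
        rw [← Complex.exp_add]; simp
      simp only [smul_eq_mul]
      linear_combination l z * h2
    rw [this]; simp
  refine ⟨⟨fun z => z + ((Complex.exp (h * f z) - 1) * l z) • v,
    fun z => z + ((Complex.exp (-h * f z) - 1) * l z) • v, fun z => key h z, fun z => ?_⟩,
    ⟨?_, ?_⟩, hA h hh, hA (-h) (by simpa using hh)⟩
  · have := key (-h) z
    rwa [neg_neg] at this
  · change Differentiable ℂ (fun z => z + ((Complex.exp (h * f z) - 1) * l z) • v); fun_prop
  · change Differentiable ℂ (fun z => z + ((Complex.exp (-h * f z) - 1) * l z) • v); fun_prop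

/-- The submodule of flow fields. -/
def FF (k : ℕ) : Submodule ℂ (EC k → EC k) where
  carrier := {V | FlowField V}
  add_mem' := fun h1 h2 => h1.add h2
  zero_mem' := by
    have := shear_field (k := k) (f := fun _ => 0) (by fun_prop) 0 (by simp)
    have h2 : (fun _ : EC k => (0 : ℂ) • (0 : EC k)) = 0 := by funext; simp
    rw [h2] at this
    exact this
  smul_mem' := fun c _ h => h.smul c

lemma coeff_extract {M : Type} [AddCommGroup M] [Module ℂ M] (S : Submodule ℂ M) (n : ℕ)
    (A B : ℕ → M) (hB : B (n + 1) = 0)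
    (h : ∀ s : ℂ, s • (∑ m ∈ Finset.range (n + 1), s ^ m • A m) -
      ∑ m ∈ Finset.range (n + 1), s ^ m • B m ∈ S) :
    B 0 ∈ S ∧ ∀ m ≤ n, A m - B (m + 1) ∈ S := by
  constructor
  · have := h 0
    rw [Finset.sum_eq_single (f := fun m => (0 : ℂ) ^ m • B m) 0 (by
      intro b _ hb; simp [hb]) (by simp)] at this
    simpa using this
  · intro m hm
    by_contra hcon
    obtain ⟨φ, hφ, hS⟩ := Submodule.exists_le_ker_of_notMem hcon
    let p : Polynomial ℂ := Polynomial.X * (∑ m ∈ Finset.range (n + 1),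
      Polynomial.C (φ (A m)) * Polynomial.X ^ m) - ∑ m ∈ Finset.range (n + 1),
      Polynomial.C (φ (B m)) * Polynomial.X ^ m
    have hp : p = 0 := by
      apply Polynomial.funext
      intro s
      have h1 : φ _ = 0 := hS (h s)
      simp only [map_sub, map_smul, map_sum, smul_eq_mul] at h1
      simp only [p, Polynomial.eval_sub, Polynomial.eval_mul, Polynomial.eval_X,
        Polynomial.eval_finsetSum, Polynomial.eval_C, Polynomial.eval_pow, Polynomial.eval_zero]
      rw [← h1]
      simp only [mul_comm]
    have hc := congrArg (fun q => Polynomial.coeff q (m + 1)) hp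
    simp only [p, Polynomial.coeff_sub, Polynomial.coeff_X_mul, Polynomial.finsetSum_coeff,
      Polynomial.coeff_C_mul_X_pow, Polynomial.coeff_zero, Finset.sum_ite_eq,
      Finset.mem_range] at hc
    rw [if_pos (by omega)] at hc
    apply hφ
    rw [map_sub]
    by_cases hmn : m + 1 < n + 1
    · rwa [if_pos hmn] at hc
    · have : m = n := by omega
      rw [if_neg hmn] at hc
      rw [this] at hc ⊢
      rw [hB, map_zero]
      exact hc

/-- basic monomial field -/
def mf {k : ℕ} (c : EC k → ℂ) (j i l : Fin k) (p q : ℕ) : EC k → EC k :=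
  fun z => (c z * z j ^ p * z i ^ q) • EuclideanSpace.single l (1 : ℂ)

lemma diff_coord {k : ℕ} (j : Fin k) : Differentiable ℂ (fun z : EC k => z j) :=
  (EuclideanSpace.proj j : EC k →L[ℂ] ℂ).differentiable

lemma shear_extract {k : ℕ} {c : EC k → ℂ} (hc : Differentiable ℂ c) {j i : Fin k} (hij : i ≠ j)
    (hcj : ∀ z : EC k, ∀ u v : ℂ,
      c (z + (u • EuclideanSpace.single j 1 + v • EuclideanSpace.single i 1)) = c z) (n : ℕ) :
    ∀ m ≤ n, ((n.choose m : ℂ) • mf c j i j (n - m) m -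
      (n.choose (m + 1) : ℂ) • mf c j i i (n - (m + 1)) (m + 1)) ∈ FF k := by
  refine (coeff_extract (FF k) n (fun m => (n.choose m : ℂ) • mf c j i j (n - m) m)
    (fun m => (n.choose m : ℂ) • mf c j i i (n - m) m) (by simp) (fun s => ?_)).2
  have h1 := shear_field (k := k) (f := fun z => c z * (s * z i + z j) ^ n)
    (by
      have h1 := diff_coord i
      have h2 := diff_coord j
      fun_prop) (s • EuclideanSpace.single j 1 - EuclideanSpace.single i 1)
    (by
      intro z t
      have e1 := hcj z (t * s) (-t)
      have e2 : z + t • (s • EuclideanSpace.single j (1 : ℂ) - EuclideanSpace.single i 1) =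
        z + ((t * s) • EuclideanSpace.single j 1 + (-t) • EuclideanSpace.single i 1) := by
        rw [smul_sub, smul_smul, neg_smul, sub_eq_add_neg]
      rw [e2, e1]
      congr 2
      simp [hij, hij.symm]
      ring)
  change FlowField _
  convert h1 using 1
  funext z
  rw [add_pow, Finset.mul_sum, Finset.sum_smul]
  simp only [mf, Pi.sub_apply, Pi.smul_apply, Finset.sum_apply, smul_sub, Finset.smul_sum,
    Finset.sum_sub_distrib, smul_smul]
  congr 1 <;> refine Finset.sum_congr rfl (fun m _ => ?_) <;> congr 1 <;> ring

lemma overshear_extract {k : ℕ} {c : EC k → ℂ} (hc : Differentiable ℂ c) {j i : Fin k}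
    (hij : i ≠ j) (hcj : ∀ z : EC k, ∀ u v : ℂ,
      c (z + (u • EuclideanSpace.single j 1 + v • EuclideanSpace.single i 1)) = c z) (n : ℕ) :
    mf c j i i n 1 ∈ FF k ∧
    ∀ m ≤ n, ((n.choose m : ℂ) • mf c j i j (n - m) (m + 1) -
      (n.choose (m + 1) : ℂ) • mf c j i i (n - (m + 1)) (m + 2)) ∈ FF k := by
  have := coeff_extract (FF k) n (fun m => (n.choose m : ℂ) • mf c j i j (n - m) (m + 1))
    (fun m => (n.choose m : ℂ) • mf c j i i (n - m) (m + 1)) (by simp) (fun s => ?_)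
  · refine ⟨by simpa using this.1, this.2⟩
  have h1 := overshear_field (k := k) (f := fun z => - (c z * (s * z i + z j) ^ n))
    (by
      have h1 := diff_coord i
      have h2 := diff_coord j
      fun_prop) (s • EuclideanSpace.single j 1 - EuclideanSpace.single i 1)
    (-(EuclideanSpace.proj i : EC k →L[ℂ] ℂ)) (by simp [hij])
    (by
      intro z t
      have e1 := hcj z (t * s) (-t)
      have e2 : z + t • (s • EuclideanSpace.single j (1 : ℂ) - EuclideanSpace.single i 1) =
        z + ((t * s) • EuclideanSpace.single j 1 + (-t) • EuclideanSpace.single i 1) := by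
        rw [smul_sub, smul_smul, neg_smul, sub_eq_add_neg]
      rw [e2, e1]
      congr 3
      simp [hij, hij.symm]
      ring)
  change FlowField _
  convert h1 using 1
  funext z
  have e3 : (-(c z * (s * z i + z j) ^ n) * (-(EuclideanSpace.proj i : EC k →L[ℂ] ℂ)) z) =
    z i * (c z * (s * z i + z j) ^ n) := by simp; ring
  rw [e3, add_pow, Finset.mul_sum, Finset.mul_sum, Finset.sum_smul]
  simp only [mf, Pi.sub_apply, Pi.smul_apply, Finset.sum_apply, smul_sub, Finset.smul_sum,
    Finset.sum_sub_distrib, smul_smul]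
  congr 1 <;> refine Finset.sum_congr rfl (fun m _ => ?_) <;> congr 1 <;> ring

lemma mf_mem {k : ℕ} {c : EC k → ℂ} (hc : Differentiable ℂ c) {j i : Fin k}
    (hij : i ≠ j) (hcj : ∀ z : EC k, ∀ u v : ℂ,
      c (z + (u • EuclideanSpace.single j 1 + v • EuclideanSpace.single i 1)) = c z) (a b : ℕ) :
    mf c j i j a b ∈ FF k := by
  rcases a with _ | a
  · refine shear_field (f := fun z => c z * z j ^ 0 * z i ^ b) ?_ _ ?_
    · have h1 := diff_coord i
      have h2 := diff_coord j
      fun_prop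
    · intro z t
      have := hcj z t 0
      rw [zero_smul, add_zero] at this
      simp [this, hij]
  · have h1 := shear_extract hc hij hcj (a + b + 1) b (by omega)
    have r1 : a + b + 1 - b = a + 1 := by omega
    have r2 : a + b + 1 - (b + 1) = a := by omega
    rw [r1, r2] at h1
    rcases b with _ | b
    · have h2 := (overshear_extract hc hij hcj a).1
      have h3 := (FF k).add_mem h1 ((FF k).smul_mem ((a + 0 + 1).choose (0 + 1) : ℂ) h2)
      simpa using h3
    · have h2 := (overshear_extract hc hij hcj (a + b + 1)).2 b (by omega)
      have r3 : a + b + 1 - b = a + 1 := by omega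
      have r4 : a + b + 1 - (b + 1) = a := by omega
      rw [r3, r4] at h2
      have h3 := (FF k).sub_mem
        ((FF k).smul_mem ((a + b + 1).choose (b + 1) : ℂ) h1)
        ((FF k).smul_mem ((a + b + 2).choose (b + 2) : ℂ) h2)
      have hne : (((a + b + 1).choose (b + 1) : ℂ) * ((a + b + 2).choose (b + 1) : ℂ) -
          ((a + b + 2).choose (b + 2) : ℂ) * ((a + b + 1).choose b : ℂ)) ≠ 0 := by
        have n1 := Nat.add_one_mul_choose_eq (a + b + 1) (b + 1)
        have n2 := Nat.add_one_mul_choose_eq (a + b + 1) b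
        have p1 : 0 < (a + b + 1).choose (b + 1) := Nat.choose_pos (by omega)
        have p2 : 0 < (a + b + 2).choose (b + 1) := Nat.choose_pos (by omega)
        have e1 : a + b + 1 + 1 = a + b + 2 := rfl
        have e2 : b + 1 + 1 = b + 2 := rfl
        rw [e1, e2] at n1
        rw [e1] at n2
        rw [sub_ne_zero]
        norm_cast
        intro heq
        generalize (a + b + 1).choose (b + 1) = x at *
        generalize (a + b + 2).choose (b + 1) = y at *
        generalize (a + b + 2).choose (b + 2) = u at *
        generalize (a + b + 1).choose b = v at *
        have e : (a + b + 2) * (x * y * (b + 2)) = (a + b + 2) * (x * y * (b + 1)) := by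
          calc (a + b + 2) * (x * y * (b + 2)) = (a + b + 2) * (u * v * (b + 2)) := by rw [heq]
            _ = (u * (b + 2)) * ((a + b + 2) * v) := by ring
            _ = ((a + b + 2) * x) * (y * (b + 1)) := by rw [n1, n2]
            _ = _ := by ring
        have e' := Nat.eq_of_mul_eq_mul_left (by omega) e
        have := Nat.eq_of_mul_eq_mul_left (Nat.mul_pos p1 p2) e'
        omega
      have h4 := (FF k).smul_mem (((a + b + 1).choose (b + 1) : ℂ) * ((a + b + 2).choose (b + 1) : ℂ) -
          ((a + b + 2).choose (b + 2) : ℂ) * ((a + b + 1).choose b : ℂ))⁻¹ h3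
      convert h4 using 1
      rw [eq_inv_smul_iff₀ hne]
      have e1 : a + (b + 1) + 1 = a + b + 2 := by ring
      rw [e1]
      module

lemma monomial_mem {k : ℕ} (hk : 2 ≤ k) (m : Fin k → ℕ) (j : Fin k) :
    (fun z : EC k => (∏ l, z l ^ m l) • EuclideanSpace.single j (1 : ℂ)) ∈ FF k := by
  have : Nontrivial (Fin k) := Fin.nontrivial_iff_two_le.2 hk
  obtain ⟨i, hij⟩ := exists_ne j
  let c : EC k → ℂ := fun z => ∏ l ∈ (Finset.univ.erase j).erase i, z l ^ m l
  have hc : Differentiable ℂ c := by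
    rw [← differentiableOn_univ]
    exact diffOn_prod _ (fun l => ((diff_coord l).pow (m l)).differentiableOn)
  have := mf_mem hc hij (by
    intro z u v
    refine Finset.prod_congr rfl (fun l hl => ?_)
    simp only [Finset.mem_erase] at hl
    simp [hl.1, hl.2.1]) (m j) (m i)
  convert this using 1
  funext z
  simp only [mf, c]
  congr 1
  rw [← Finset.mul_prod_erase Finset.univ (fun l => z l ^ m l) (Finset.mem_univ j),
    ← Finset.mul_prod_erase (Finset.univ.erase j) (fun l => z l ^ m l)
      (Finset.mem_erase.2 ⟨hij, Finset.mem_univ i⟩)]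
  ring

lemma poly_mem {k : ℕ} (hk : 2 ≤ k) (P : Fin k → MvPolynomial (Fin k) ℂ) :
    FlowField (fun z : EC k => WithLp.toLp 2 (fun j => MvPolynomial.eval (fun i => z i) (P j))) := by
  have : (fun z : EC k => WithLp.toLp 2 (fun j => MvPolynomial.eval (fun i => z i) (P j))) =
    ∑ j, ∑ d ∈ (P j).support, (P j).coeff d •
      (fun z : EC k => (∏ l, z l ^ d l) • EuclideanSpace.single j (1 : ℂ)) := by
    funext z
    ext l
    simp only [Finset.sum_apply, Pi.smul_apply]
    simp only [WithLp.ofLp_sum, Finset.sum_apply, WithLp.ofLp_smul, Pi.smul_apply,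
      PiLp.single_apply, smul_eq_mul]
    rw [Finset.sum_eq_single l]
    · rw [MvPolynomial.eval_eq']
      simp
    · intro b _ hb
      simp [hb.symm]
    · simp
  rw [this]
  change _ ∈ FF k
  exact (FF k).sum_mem (fun j _ => (FF k).sum_mem (fun d _ =>
    (FF k).smul_mem _ (monomial_mem hk _ j)))

/-- `f` is a biholomorphism of the whole space onto `Ω` with inverse `g`. -/
structure Bih {k : ℕ} (f g : EC k → EC k) (Ω : Set (EC k)) : Prop where
  hf : Differentiable ℂ f
  hΩ : IsOpen Ω
  hg : DifferentiableOn ℂ g Ω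
  mem : ∀ z, f z ∈ Ω
  gf : ∀ z, g (f z) = z
  fg : ∀ y ∈ Ω, f (g y) = y

lemma loc_lip {k : ℕ} {f g : EC k → EC k} {Ω : Set (EC k)} (h : Bih f g Ω) (R : ℝ) :
    ∃ ρ > 0, ∃ L > 0, ∀ w ∈ closedBall (0 : EC k) R, ∀ y, ‖y - f w‖ ≤ ρ →
      y ∈ Ω ∧ ‖g y - w‖ ≤ L * ‖y - f w‖ := by
  have hK : IsCompact (f '' closedBall 0 R) :=
    (isCompact_closedBall (0 : EC k) R).image h.hf.continuous
  have hKΩ : f '' closedBall 0 R ⊆ Ω := by rintro _ ⟨z, -, rfl⟩; exact h.mem z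
  obtain ⟨δ, hδ, hsub⟩ := hK.exists_cthickening_subset_open h.hΩ hKΩ
  have hK2 : IsCompact (cthickening δ (f '' closedBall 0 R)) := hK.cthickening
  obtain ⟨M, hM⟩ := hK2.exists_bound_of_continuousOn (h.hg.continuousOn.mono hsub)
  have hball : ∀ w ∈ closedBall (0 : EC k) R, closedBall (f w) δ ⊆
      cthickening δ (f '' closedBall 0 R) := fun w hw =>
    closedBall_subset_cthickening (mem_image_of_mem f hw) δ
  refine ⟨δ / 2, by positivity, (2 * |M| + 1) / δ, by positivity, fun w hw y hy => ?_⟩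
  have hyb : y ∈ ball (f w) δ := by rw [mem_ball, dist_eq_norm]; linarith
  refine ⟨hsub (hball w hw (ball_subset_closedBall hyb)), ?_⟩
  have := Complex.dist_le_div_mul_dist_of_mapsTo_ball (f := g) (c := f w) (R₁ := δ)
    (R₂ := 2 * |M| + 1) (z := y)
    (h.hg.mono (ball_subset_closedBall.trans ((hball w hw).trans hsub)))
    (by
      intro x hx
      rw [mem_closedBall, dist_eq_norm]
      have h1 := hM x (hball w hw (ball_subset_closedBall hx))
      have h2 := hM (f w) (hball w hw (mem_closedBall_self hδ.le))
      have := norm_sub_le (g x) (g (f w))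
      have := le_abs_self M
      linarith) hyb
  rw [h.gf, dist_eq_norm, dist_eq_norm] at this
  exact this

lemma norm_le_of_coord {k : ℕ} {x : EC k} {ε : ℝ} (hε : 0 ≤ ε) (h : ∀ i, ‖x i‖ ≤ ε) :
    ‖x‖ ≤ (k + 1) * ε := by
  have h1 : ‖x‖ ^ 2 = ∑ i, ‖x i‖ ^ 2 := EuclideanSpace.norm_sq_eq x
  have h2 : ∑ i, ‖x i‖ ^ 2 ≤ ∑ i : Fin k, ε ^ 2 :=
    Finset.sum_le_sum (fun i _ => pow_le_pow_left₀ (norm_nonneg _) (h i) 2)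
  simp at h2
  refine le_of_sq_le_sq (a := ‖x‖) ?_ (by positivity)
  nlinarith [sq_nonneg ε, sq_nonneg ((k : ℝ) * ε), (Nat.cast_nonneg k : (0 : ℝ) ≤ k), mul_nonneg (Nat.cast_nonneg k : (0 : ℝ) ≤ k) (sq_nonneg ε)]

lemma dil_taylor {k : ℕ} {f : EC k → EC k} (hf : Differentiable ℂ f) {R : ℝ} (hR : 0 ≤ R) :
    ∃ C > 0, ∀ t : ℝ, |t| ≤ 1 → ∀ z ∈ closedBall (0 : EC k) R,
      ‖f ((Real.exp t : ℂ) • z) - f z - (t : ℂ) • fderiv ℂ f z z‖ ≤ C * t ^ 2 := by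
  obtain ⟨M, hM0, hM⟩ := cont_bdd hf.continuous (R + 2 * (R + 1))
  have hc : Continuous (fun z => fderiv ℂ f z z) := by
    have : Differentiable ℂ (fderiv ℂ f) := differentiableOn_univ.1
      (holo_fderiv isOpen_univ hf.differentiableOn)
    have := this.continuous
    fun_prop
  obtain ⟨M1, hM10, hM1⟩ := cont_bdd hc R
  refine ⟨4 * M + M1, by positivity, fun t ht z hz => ?_⟩
  have hzR : ‖z‖ ≤ R := by simpa using hz
  have he2 : ‖(Real.exp t : ℂ) - 1‖ ≤ 2 * |t| := by
    have := Complex.norm_exp_sub_one_le (x := (t : ℂ)) (by simpa using ht)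
    simpa using this
  have he3 : ‖(Real.exp t : ℂ) - 1 - t‖ ≤ t ^ 2 := by
    have := Complex.norm_exp_sub_one_sub_id_le (x := (t : ℂ)) (by simpa using ht)
    simpa using this
  have hd : (Real.exp t : ℂ) • z - z = ((Real.exp t : ℂ) - 1) • z := by rw [sub_smul, one_smul]
  have hdn : ‖(Real.exp t : ℂ) • z - z‖ ≤ 2 * |t| * R := by
    rw [hd, norm_smul]
    exact mul_le_mul he2 hzR (norm_nonneg _) (by positivity)
  have hr : (0 : ℝ) < 2 * (R + 1) := by positivity
  have hin : (Real.exp t : ℂ) • z ∈ ball z (2 * (R + 1)) := by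
    rw [mem_ball, dist_eq_norm]
    refine hdn.trans_lt ?_
    nlinarith
  have hT := holo_taylor (f := f) (c := z) (r := 2 * (R + 1)) (M := 2 * M) hr hf.differentiableOn
    (by
      intro x hx
      rw [mem_ball, dist_eq_norm] at hx
      have h1 := hM x (by
        rw [mem_closedBall, dist_zero_right]
        have : x = z + (x - z) := by abel
        rw [this]
        exact (norm_add_le _ _).trans (by linarith))
      have h2 := hM z (closedBall_subset_closedBall (by linarith) hz)
      exact (norm_sub_le _ _).trans (by linarith)) _ hin
  have hq : (‖(Real.exp t : ℂ) • z - z‖ / (2 * (R + 1))) ^ 2 ≤ t ^ 2 := by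
    rw [← sq_abs t]
    refine pow_le_pow_left₀ (by positivity) ?_ 2
    rw [div_le_iff₀ hr]
    nlinarith [abs_nonneg t]
  have : f ((Real.exp t : ℂ) • z) - f z - (t : ℂ) • fderiv ℂ f z z =
    (f ((Real.exp t : ℂ) • z) - f z - fderiv ℂ f z ((Real.exp t : ℂ) • z - z)) +
      ((Real.exp t : ℂ) - 1 - t) • fderiv ℂ f z z := by
    rw [hd, map_smul, sub_smul _ (t : ℂ)]; abel
  rw [this]
  refine (norm_add_le _ _).trans ?_
  rw [norm_smul]
  have h5 := mul_le_mul he3 (hM1 z hz) (norm_nonneg _) (by positivity)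
  nlinarith

/-- definition of the Runge property, as used here. -/
def RungeP {k : ℕ} (Ω : Set (EC k)) : Prop :=
  ∀ f : EC k → ℂ, DifferentiableOn ℂ f Ω →
    ∀ K ⊆ Ω, IsCompact K → ∀ ε > (0 : ℝ),
      ∃ P : MvPolynomial (Fin k) ℂ, ∀ z ∈ K, ‖f z - MvPolynomial.eval (fun i => z i) P‖ < ε

lemma step_lemma {k : ℕ} (hk : 2 ≤ k) {f g : EC k → EC k} {Ω : Set (EC k)} (h : Bih f g Ω)
    (hR : RungeP Ω) {R : ℝ} (hR0 : 0 ≤ R) {ε : ℝ} (hε : 0 < ε) :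
    ∃ τ0 > 0, ∀ τ : ℝ, 0 < τ → τ < τ0 → ∃ Ψ : EC k ≃ EC k, IsAut Ψ ∧
      ∀ z ∈ closedBall (0 : EC k) R,
        (Ψ (f z) ∈ Ω ∧ ‖g (Ψ (f z)) - (Real.exp τ : ℂ) • z‖ ≤ ε * τ) ∧
        (Ψ.symm (f z) ∈ Ω ∧ ‖g (Ψ.symm (f z)) - (Real.exp (-τ) : ℂ) • z‖ ≤ ε * τ) := by
  obtain ⟨ρ, hρ, L, hL, hlip⟩ := loc_lip h (3 * R)
  obtain ⟨C, hC, htay⟩ := dil_taylor h.hf hR0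
  set ε2 := ε / (4 * L) with hε2
  have hε2p : 0 < ε2 := by positivity
  -- the field
  let X : EC k → EC k := fun w => fderiv ℂ f (g w) (g w)
  have hX : DifferentiableOn ℂ X Ω := by
    have h1 : Differentiable ℂ (fderiv ℂ f) := differentiableOn_univ.1
      (holo_fderiv isOpen_univ h.hf.differentiableOn)
    exact (h1.comp_differentiableOn h.hg).clm_apply h.hg
  have hK : IsCompact (f '' closedBall 0 R) :=
    (isCompact_closedBall (0 : EC k) R).image h.hf.continuous
  have hKΩ : f '' closedBall 0 R ⊆ Ω := by rintro _ ⟨z, -, rfl⟩; exact h.mem z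
  have hex : ∀ j : Fin k, ∃ P : MvPolynomial (Fin k) ℂ, ∀ z ∈ f '' closedBall 0 R,
      ‖X z j - MvPolynomial.eval (fun i => z i) P‖ < ε2 / (k + 1) := fun j =>
    hR (fun w => X w j) ((diff_coord j).comp_differentiableOn hX) _ hKΩ hK _ (by positivity)
  choose P hP using hex
  let V : EC k → EC k := fun z => WithLp.toLp 2 (fun j => MvPolynomial.eval (fun i => z i) (P j))
  have hV : FlowField V := poly_mem hk P
  have hXV : ∀ w ∈ f '' closedBall 0 R, ‖V w - X w‖ ≤ ε2 := by
    intro w hw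
    have := norm_le_of_coord (x := V w - X w) (ε := ε2 / (k + 1)) (by positivity) (by
      intro j
      have := (hP j w hw).le
      rw [norm_sub_rev] at this
      exact this)
    refine this.trans (le_of_eq ?_)
    field_simp
  obtain ⟨Rf, hRf0, hRf⟩ := cont_bdd h.hf.continuous R
  obtain ⟨h0, hh0, hflow⟩ := hV.2 Rf ε2 hε2p
  refine ⟨min (min 1 h0) (min (ε2 / C) (ρ / (3 * ε2))), by positivity, fun τ hτ hτ0 => ?_⟩
  simp only [lt_min_iff] at hτ0
  obtain ⟨⟨hτ1, hτh⟩, hτC, hτρ⟩ := hτ0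
  rw [lt_div_iff₀ hC] at hτC
  rw [lt_div_iff₀ (by positivity)] at hτρ
  obtain ⟨Ψ, hΨ, hA, hB⟩ := hflow (τ : ℂ) (by simpa [abs_of_pos hτ] using hτh)
  refine ⟨Ψ, hΨ, fun z hz => ?_⟩
  have key : ∀ (t : ℝ) (A : EC k → EC k), |t| = τ → Apx V (t : ℂ) ε2 Rf A →
      A (f z) ∈ Ω ∧ ‖g (A (f z)) - (Real.exp t : ℂ) • z‖ ≤ ε * τ := by
    intro t A ht hA
    have e1 := hA (f z) (by simpa using hRf z hz)
    rw [Complex.norm_real, Real.norm_eq_abs, ht] at e1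
    have e2 := hXV (f z) (mem_image_of_mem f hz)
    have e3 := htay t (by linarith) z hz
    have hXf : X (f z) = fderiv ℂ f z z := by simp only [X, h.gf]
    rw [← hXf, ← sq_abs, ht] at e3
    have e4 : A (f z) - f ((Real.exp t : ℂ) • z) = (A (f z) - f z - (t : ℂ) • V (f z)) +
      (t : ℂ) • (V (f z) - X (f z)) - (f ((Real.exp t : ℂ) • z) - f z - (t : ℂ) • X (f z)) := by
      rw [smul_sub]; abel
    have e5 : ‖A (f z) - f ((Real.exp t : ℂ) • z)‖ ≤ 3 * ε2 * τ := by
      rw [e4]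
      refine (norm_sub_le _ _).trans ?_
      have := norm_add_le (A (f z) - f z - (t : ℂ) • V (f z)) ((t : ℂ) • (V (f z) - X (f z)))
      rw [norm_smul, Complex.norm_real, Real.norm_eq_abs, ht] at this
      nlinarith
    have e6 := hlip ((Real.exp t : ℂ) • z) (by
      rw [mem_closedBall, dist_zero_right, norm_smul, Complex.norm_real,
        Real.norm_of_nonneg (Real.exp_pos t).le]
      have h3 : Real.exp t ≤ 3 := by
        have : Real.exp t ≤ Real.exp 1 := Real.exp_le_exp.2 (by linarith [le_abs_self t])
        linarith [Real.exp_one_lt_d9]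
      have : ‖z‖ ≤ R := by simpa using hz
      exact mul_le_mul h3 this (norm_nonneg _) (by norm_num)) (A (f z))
      (e5.trans (by linarith))
    refine ⟨e6.1, e6.2.trans ?_⟩
    have e7 := mul_le_mul_of_nonneg_left e5 hL.le
    refine e7.trans ?_
    have : L * (3 * ε2 * τ) = 3 / 4 * (ε * τ) := by rw [hε2]; field_simp
    rw [this]
    nlinarith [mul_pos hε hτ]
  exact ⟨key τ Ψ (abs_of_pos hτ) hA, key (-τ) Ψ.symm (by rw [abs_neg, abs_of_pos hτ])
    (by push_cast; exact hB)⟩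

/-- `A` approximates `f` on the closed ball of radius `s` with error `e`. -/
def ApxOn {k : ℕ} (f g : EC k → EC k) (Ω : Set (EC k)) (A : EC k ≃ EC k) (s e : ℝ) : Prop :=
  ∀ z ∈ closedBall (0 : EC k) s, A z ∈ Ω ∧ ‖g (A z) - z‖ ≤ e ∧ ‖A.symm (f z) - z‖ ≤ e

open scoped Topology in
lemma near_id {k : ℕ} {F : EC k → EC k} (h0 : F 0 = 0)
    (hF : HasFDerivAt F (ContinuousLinearMap.id ℂ (EC k)) 0) {κ : ℝ} (hκ : 0 < κ) :
    ∀ᶠ z in 𝓝 0, ‖F z - z‖ ≤ κ * ‖z‖ := by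
  have := (hasFDerivAt_iff_isLittleO.1 hF).def hκ
  filter_upwards [this] with z hz
  simpa [h0] using hz

open scoped Topology in
lemma al_base {k : ℕ} {f g : EC k → EC k} {Ω : Set (EC k)} (h : Bih f g Ω) {κ : ℝ} (hκ : 0 < κ) :
    ∃ ρ > 0, ρ ≤ 1 ∧ ∃ A : EC k ≃ EC k, IsAut A ∧ ApxOn f g Ω A ρ (κ * ρ) := by
  have hf0 : HasFDerivAt f (fderiv ℂ f 0) 0 := (h.hf 0).hasFDerivAt
  have hg0 : HasFDerivAt g (fderiv ℂ g (f 0)) (f 0) :=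
    (h.hg.differentiableAt (h.hΩ.mem_nhds (h.mem 0))).hasFDerivAt
  have h1 : (fderiv ℂ g (f 0)).comp (fderiv ℂ f 0) = ContinuousLinearMap.id ℂ (EC k) := by
    refine (hg0.comp (0 : EC k) hf0).unique ?_
    have : g ∘ f = id := funext h.gf
    rw [this]; exact hasFDerivAt_id _
  have h2 : (fderiv ℂ f 0).comp (fderiv ℂ g (f 0)) = ContinuousLinearMap.id ℂ (EC k) := by
    have hf0' : HasFDerivAt f (fderiv ℂ f 0) (g (f 0)) := by rw [h.gf]; exact hf0
    refine (hf0'.comp (f 0) hg0).unique ?_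
    refine (hasFDerivAt_id (f 0)).congr_of_eventuallyEq ?_
    filter_upwards [h.hΩ.mem_nhds (h.mem 0)] with y hy
    exact h.fg y hy
  let B := fderiv ℂ g (f 0)
  let D := fderiv ℂ f 0
  have hBD : ∀ x, B (D x) = x := fun x => congrArg (fun T : EC k →L[ℂ] EC k => T x) h1
  have hDB : ∀ x, D (B x) = x := fun x => congrArg (fun T : EC k →L[ℂ] EC k => T x) h2
  let A : EC k ≃ EC k := ⟨fun z => f 0 + D z, fun y => B (y - f 0), fun z => by simp [hBD],
    fun y => by simp [hDB]⟩
  have hA1 : HasFDerivAt (fun z => f 0 + D z) D 0 := D.hasFDerivAt.const_add _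
  have hA : IsAut A := ⟨D.differentiable.const_add _, B.differentiable.comp
    (differentiable_id.sub_const _)⟩
  have e1 : ∀ᶠ z in 𝓝 (0 : EC k), ‖g (f 0 + D z) - z‖ ≤ κ * ‖z‖ := by
    refine near_id (F := fun z => g (f 0 + D z)) (by simp [h.gf]) ?_ hκ
    rw [← h1]
    have hg0' : HasFDerivAt g (fderiv ℂ g (f 0)) (f 0 + D 0) := by simpa using hg0
    exact hg0'.comp (0 : EC k) hA1
  have e2 : ∀ᶠ z in 𝓝 (0 : EC k), ‖B (f z - f 0) - z‖ ≤ κ * ‖z‖ := by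
    refine near_id (F := fun z => B (f z - f 0)) (by simp) ?_ hκ
    rw [← h1]
    exact B.hasFDerivAt.comp (0 : EC k) (hf0.sub_const (f 0))
  have e3 : ∀ᶠ z in 𝓝 (0 : EC k), f 0 + D z ∈ Ω := by
    have : ContinuousAt (fun z => f 0 + D z) 0 := hA1.continuousAt
    exact this (h.hΩ.mem_nhds (by simpa using h.mem 0))
  obtain ⟨r, hr, hb⟩ := Metric.eventually_nhds_iff_ball.1 (e1.and (e2.and e3))
  refine ⟨min (r / 2) 1, by positivity, min_le_right _ _, A, hA, fun z hz => ?_⟩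
  have hz' : ‖z‖ ≤ min (r / 2) 1 := by simpa using hz
  have := hb z (by
    rw [mem_ball, dist_zero_right]
    have := hz'.trans (min_le_left _ _)
    linarith)
  have hm := mul_le_mul_of_nonneg_left hz' hκ.le
  exact ⟨this.2.2, this.1.trans hm, this.2.1.trans hm⟩

lemma al_step {k : ℕ} {f g : EC k → EC k} {Ω : Set (EC k)} (h : Bih f g Ω) {A Ψ : EC k ≃ EC k}
    (hA : IsAut A) (hΨ : IsAut Ψ) {s e R d τ : ℝ} (hτ : 0 ≤ τ) (hAp : ApxOn f g Ω A s e)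
    (hd : 0 ≤ d) (hs1 : s + e ≤ R) (hs2 : Real.exp τ * (s - d) ≤ R)
    (hΨp : ∀ z ∈ closedBall (0 : EC k) R,
        (Ψ (f z) ∈ Ω ∧ ‖g (Ψ (f z)) - (Real.exp τ : ℂ) • z‖ ≤ d) ∧
        (Ψ.symm (f z) ∈ Ω ∧ ‖g (Ψ.symm (f z)) - (Real.exp (-τ) : ℂ) • z‖ ≤ d)) :
    ∃ A' : EC k ≃ EC k, IsAut A' ∧
      ApxOn f g Ω A' (Real.exp τ * (s - d)) (Real.exp τ * (e + d)) := by
  have he : Real.exp τ * Real.exp (-τ) = 1 := by rw [← Real.exp_add]; simp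
  have hec : (Real.exp τ : ℂ) * (Real.exp (-τ) : ℂ) = 1 := by exact_mod_cast he
  have hec' : (Real.exp (-τ) : ℂ) * (Real.exp τ : ℂ) = 1 := by rw [mul_comm]; exact hec
  have hr1 : 1 ≤ Real.exp τ := Real.one_le_exp hτ
  let Δ : EC k ≃ EC k := ⟨fun z => (Real.exp (-τ) : ℂ) • z, fun z => (Real.exp τ : ℂ) • z,
    fun z => by simp only [smul_smul]; rw [hec, one_smul],
    fun z => by simp only [smul_smul]; rw [hec', one_smul]⟩
  have hΔ : IsAut Δ := ⟨differentiable_id.const_smul _, differentiable_id.const_smul _⟩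
  refine ⟨(Δ.trans A).trans Ψ, (hΔ.trans hA).trans hΨ, fun z hz => ?_⟩
  have hz1 : ‖z‖ ≤ Real.exp τ * (s - d) := by simpa using hz
  have hz2 : ‖(Real.exp (-τ) : ℂ) • z‖ ≤ s - d := by
    rw [norm_smul, Complex.norm_real, Real.norm_of_nonneg (Real.exp_pos _).le]
    have := mul_le_mul_of_nonneg_left hz1 (Real.exp_pos (-τ)).le
    rwa [← mul_assoc, mul_comm (Real.exp (-τ)) (Real.exp τ), he, one_mul] at this
  set z' := (Real.exp (-τ) : ℂ) • z with hz'
  have hzz : (Real.exp τ : ℂ) • z' = z := by rw [hz', smul_smul, hec, one_smul]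
  have hnorm : ∀ x : EC k, ‖(Real.exp τ : ℂ) • x‖ = Real.exp τ * ‖x‖ := fun x => by
    rw [norm_smul, Complex.norm_real, Real.norm_of_nonneg (Real.exp_pos _).le]
  obtain ⟨a1, a2, -⟩ := hAp z' (by rw [mem_closedBall, dist_zero_right]; linarith)
  set w := g (A z') with hw
  have hfw : f w = A z' := h.fg _ a1
  have hwR : w ∈ closedBall (0 : EC k) R := by
    rw [mem_closedBall, dist_zero_right]
    have : w = (w - z') + z' := by abel
    rw [this]
    exact (norm_add_le _ _).trans (by linarith)
  obtain ⟨⟨b1, b2⟩, -⟩ := hΨp w hwR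
  rw [hfw] at b1 b2
  refine ⟨b1, ?_, ?_⟩
  · change ‖g (Ψ (A z')) - z‖ ≤ _
    have : g (Ψ (A z')) - z = (g (Ψ (A z')) - (Real.exp τ : ℂ) • w) +
        (Real.exp τ : ℂ) • (w - z') := by rw [smul_sub, hzz]; abel
    rw [this]
    refine (norm_add_le _ _).trans ?_
    rw [hnorm]
    nlinarith
  · change ‖(Real.exp τ : ℂ) • A.symm (Ψ.symm (f z)) - z‖ ≤ _
    obtain ⟨-, c1, c2⟩ := hΨp z (closedBall_subset_closedBall hs2 hz)
    set u := g (Ψ.symm (f z)) with hu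
    have hfu : f u = Ψ.symm (f z) := h.fg _ c1
    have hus : ‖u‖ ≤ s := by
      have : u = (u - z') + z' := by abel
      rw [this]
      exact (norm_add_le _ _).trans (by linarith)
    obtain ⟨-, -, d3⟩ := hAp u (by simpa using hus)
    rw [hfu] at d3
    have : (Real.exp τ : ℂ) • A.symm (Ψ.symm (f z)) - z =
      (Real.exp τ : ℂ) • ((A.symm (Ψ.symm (f z)) - u) + (u - z')) := by
      rw [smul_add, smul_sub, smul_sub, hzz]; abel
    rw [this, hnorm]
    gcongr
    exact (norm_add_le _ _).trans (by linarith)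

lemma al_lemma {k : ℕ} (hk : 2 ≤ k) {f g : EC k → EC k} {Ω : Set (EC k)} (h : Bih f g Ω)
    (hRu : RungeP Ω) (R0 : ℝ) {η0 : ℝ} (hη0 : 0 < η0) :
    ∃ A : EC k ≃ EC k, IsAut A ∧ ApxOn f g Ω A R0 η0 := by
  set R := max R0 1 with hRdef
  have hR : 1 ≤ R := le_max_right _ _
  set η := min η0 1 with hηdef
  have hη : 0 < η := lt_min hη0 one_pos
  have hη1 : η ≤ 1 := min_le_right _ _
  obtain ⟨ρ, hρ, hρ1, A0, hA0, hAp0⟩ := al_base h (κ := η / (2 * (R + 1))) (by positivity)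
  set κ := η / (2 * (R + 1)) with hκ
  have hκp : 0 < κ := by positivity
  set M := (R + 1) / ρ with hM
  have hM1 : 1 < M := by rw [hM, one_lt_div hρ]; linarith
  set T := Real.log M with hT
  have hTp : 0 < T := Real.log_pos hM1
  have hexpT : Real.exp T = M := Real.exp_log (by linarith)
  set ε := η / (2 * M * (T + 1)) with hε
  have hεp : 0 < ε := by positivity
  have hMρ : M * ρ = R + 1 := by rw [hM]; field_simp
  have hMTε : M * (T * ε) ≤ η / 2 := by
    have : M * ((T + 1) * ε) = η / 2 := by rw [hε]; field_simp
    have h2 : M * (T * ε) ≤ M * ((T + 1) * ε) := by gcongr; linarith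
    linarith
  have hκR : κ * (R + 1) = η / 2 := by rw [hκ]; field_simp
  obtain ⟨τ0, hτ0, hstep⟩ := step_lemma hk h hRu (R := R + 3) (by linarith) hεp
  obtain ⟨N, hN⟩ := exists_nat_gt (T / τ0)
  have hNp : 0 < (N : ℝ) := lt_trans (by positivity) hN
  set τ := T / N with hτ
  have hτp : 0 < τ := by positivity
  have hNτ : N * τ = T := by rw [hτ]; field_simp
  have hττ : τ < τ0 := by
    rw [hτ, div_lt_iff₀ hNp]; rw [div_lt_iff₀ hτ0] at hN; linarith
  obtain ⟨Ψ, hΨ, hΨp⟩ := hstep τ hτp hττ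
  have hind : ∀ n : ℕ, n ≤ N → ∃ A : EC k ≃ EC k, IsAut A ∧
      ApxOn f g Ω A (Real.exp (n * τ) * (ρ - n * (ε * τ)))
        (Real.exp (n * τ) * (κ * ρ + n * (ε * τ))) := by
    intro n
    induction n with
    | zero => intro _; exact ⟨A0, hA0, by simpa using hAp0⟩
    | succ n ih =>
      intro hn
      obtain ⟨A, hA, hAp⟩ := ih (by omega)
      have hnN : ((n : ℝ) + 1) ≤ N := by exact_mod_cast hn
      have hexp1 : Real.exp (n * τ) * Real.exp τ ≤ M := by
        rw [← hexpT, ← Real.exp_add]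
        refine Real.exp_le_exp.2 ?_
        nlinarith
      have hexp0 : Real.exp (n * τ) ≤ M := by
        rw [← hexpT]
        refine Real.exp_le_exp.2 ?_
        nlinarith
      have hnτ : n * (ε * τ) ≤ T * ε := by nlinarith [mul_pos hεp hτp]
      have hn0 : (0 : ℝ) ≤ n := Nat.cast_nonneg n
      have hετ : 0 < ε * τ := mul_pos hεp hτp
      have hE1 : 1 ≤ Real.exp (n * τ) := Real.one_le_exp (by positivity)
      have hEτ : 1 ≤ Real.exp τ := Real.one_le_exp (by positivity)
      have bE : Real.exp (n * τ) * (κ * ρ + n * (ε * τ)) ≤ 1 := by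
        calc _ ≤ M * (κ * ρ + T * ε) := by gcongr
          _ = κ * (M * ρ) + M * (T * ε) := by ring
          _ ≤ 1 := by rw [hMρ]; linarith
      have bS : Real.exp (n * τ) * (ρ - n * (ε * τ)) ≤ R + 1 := by
        calc _ ≤ Real.exp (n * τ) * ρ := by gcongr; nlinarith
          _ ≤ M * ρ := by gcongr
          _ = _ := hMρ
      obtain ⟨A', hA', hAp'⟩ := al_step h hA hΨ (d := Real.exp (n * τ) * (ε * τ)) (R := R + 3)
        hτp.le hAp (by positivity) (by linarith) (by
          calc _ ≤ Real.exp τ * (Real.exp (n * τ) * ρ) := by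
                gcongr
                have e1 : 0 ≤ Real.exp (n * τ) * (n * (ε * τ)) := by positivity
                have e2 : 0 ≤ Real.exp (n * τ) * (ε * τ) := by positivity
                linarith
            _ = (Real.exp (n * τ) * Real.exp τ) * ρ := by ring
            _ ≤ M * ρ := by gcongr
            _ ≤ R + 3 := by rw [hMρ]; linarith)
        (fun z hz => by
          have h1 := hΨp z hz
          have h2 : ε * τ ≤ Real.exp (n * τ) * (ε * τ) := le_mul_of_one_le_left hετ.le hE1
          exact ⟨⟨h1.1.1, h1.1.2.trans h2⟩, h1.2.1, h1.2.2.trans h2⟩)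
      refine ⟨A', hA', ?_⟩
      have r0 : Real.exp (((n + 1 : ℕ) : ℝ) * τ) = Real.exp τ * Real.exp (n * τ) := by
        rw [← Real.exp_add]; congr 1; push_cast; ring
      convert hAp' using 1
      · rw [r0]; push_cast; ring
      · rw [r0]; push_cast; ring
  obtain ⟨A, hA, hAp⟩ := hind N le_rfl
  refine ⟨A, hA, fun z hz => ?_⟩
  have eN : (N : ℝ) * (ε * τ) = T * ε := by rw [← hNτ]; ring
  rw [hNτ, hexpT, eN] at hAp
  have := hAp z (by
    refine closedBall_subset_closedBall ?_ hz
    have : M * (ρ - T * ε) = R + 1 - M * (T * ε) := by rw [← hMρ]; ring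
    rw [this]
    have := le_max_left R0 1
    linarith)
  have hfin : M * (κ * ρ + T * ε) ≤ η0 := by
    have e : M * (κ * ρ + T * ε) = κ * (M * ρ) + M * (T * ε) := by ring
    rw [e, hMρ, hκR]
    have := min_le_left η0 1
    linarith
  exact ⟨this.1, this.2.1.trans hfin, this.2.2.trans hfin⟩

lemma Bih.comp_aut {k : ℕ} {f g : EC k → EC k} {Ω : Set (EC k)} (h : Bih f g Ω)
    {Φ : EC k ≃ EC k} (hΦ : IsAut Φ) : Bih (fun z => f (Φ z)) (fun y => Φ.symm (g y)) Ω where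
  hf := h.hf.comp hΦ.1
  hΩ := h.hΩ
  hg := hΦ.2.comp_differentiableOn h.hg
  mem := fun z => h.mem _
  gf := fun z => by simp [h.gf]
  fg := fun y hy => by simp [h.fg y hy]

lemma push_out {k : ℕ} (hk : 2 ≤ k) {G H F g : EC k → EC k} {Ω1 Ω2 : Set (EC k)}
    (h1 : Bih G H Ω1) (h2 : Bih F g Ω2) (hsub : Ω1 ⊆ Ω2) (hr1 : RungeP Ω1) (hr2 : RungeP Ω2)
    (R : ℝ) {η : ℝ} (hη : 0 < η) : ∃ Φ : EC k ≃ EC k, IsAut Φ ∧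
      ∀ z ∈ closedBall (0 : EC k) R, ‖F (Φ z) - G z‖ ≤ η ∧ ‖Φ.symm (g (G z)) - z‖ ≤ η := by
  obtain ⟨ρ, hρ, L, hL, hlip⟩ := loc_lip h1 R
  have hgG : Continuous (fun z => g (G z)) :=
    h2.hg.continuousOn.comp_continuous h1.hf.continuous (fun z => hsub (h1.mem z))
  obtain ⟨R2, hR2, hbd⟩ := cont_bdd hgG (R + 1)
  obtain ⟨d1, hd1, hG⟩ := cont_unif h1.hf.continuous (R + 1) (ε := η / 2) (by positivity)
  set δ := min (min (η / 2) ρ) (min (η / (2 * L)) (1 / L)) with hδ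
  have hδp : 0 < δ := by positivity
  have hδ1 : δ ≤ η / 2 := (min_le_left _ _).trans (min_le_left _ _)
  have hδ2 : δ ≤ ρ := (min_le_left _ _).trans (min_le_right _ _)
  have hδ3 : L * δ ≤ η / 2 := by
    have : δ ≤ η / (2 * L) := (min_le_right _ _).trans (min_le_left _ _)
    rw [le_div_iff₀ (by positivity)] at this
    linarith
  have hδ4 : L * δ ≤ 1 := by
    have : δ ≤ 1 / L := (min_le_right _ _).trans (min_le_right _ _)
    rw [le_div_iff₀ (by positivity)] at this
    linarith
  obtain ⟨d2, hd2, hF⟩ := cont_unif h2.hf.continuous (R2 + 1) hδp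
  set e1 := min (min (η / 2) 1) (d1 / 2) with he1
  have he1p : 0 < e1 := by positivity
  have he11 : e1 ≤ η / 2 := (min_le_left _ _).trans (min_le_left _ _)
  have he12 : e1 ≤ 1 := (min_le_left _ _).trans (min_le_right _ _)
  have he13 : e1 ≤ d1 / 2 := min_le_right _ _
  set e2 := min 1 (d2 / 2) with he2
  have he2p : 0 < e2 := by positivity
  have he21 : e2 ≤ 1 := min_le_left _ _
  have he22 : e2 ≤ d2 / 2 := min_le_right _ _
  obtain ⟨β, hβ, hβp⟩ := al_lemma hk h1 hr1 (R + 1) he1p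
  obtain ⟨α, hα, hαp⟩ := al_lemma hk h2 hr2 R2 he2p
  have tri : ∀ (x y : EC k) (a b : ℝ), ‖x - y‖ ≤ a → ‖y‖ ≤ b → ‖x‖ ≤ b + a := by
    intro x y a b hxy hy
    have : x = (x - y) + y := by abel
    rw [this]
    exact (norm_add_le _ _).trans (by linarith)
  refine ⟨β.trans α.symm, hβ.trans hα.symm, fun z hz => ⟨?_, ?_⟩⟩
  · change ‖F (α.symm (β z)) - G z‖ ≤ η
    have hz1 : z ∈ closedBall (0 : EC k) (R + 1) := closedBall_subset_closedBall (by linarith) hz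
    have hzR : ‖z‖ ≤ R := by simpa using hz
    obtain ⟨b1, b2, -⟩ := hβp z hz1
    set w := H (β z) with hw
    have hGw : G w = β z := h1.fg _ b1
    have hwR : w ∈ closedBall (0 : EC k) (R + 1) := by
      have := tri _ _ _ _ b2 hzR
      simp only [mem_closedBall, dist_zero_right]; linarith
    set u := g (G w) with hu
    have hFu : F u = β z := by rw [hu, hGw]; exact h2.fg _ (hsub b1)
    have huR : ‖u‖ ≤ R2 := hbd w hwR
    obtain ⟨-, -, a3⟩ := hαp u (by simpa using huR)
    rw [hFu] at a3
    have c1 := hF (α.symm (β z)) (by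
      have := tri _ _ _ _ a3 huR
      simp only [mem_closedBall, dist_zero_right]; linarith) u (by
      simp only [mem_closedBall, dist_zero_right]; linarith) (by linarith)
    have c2 := hG w hwR z hz1 (by linarith)
    rw [hFu, ← hGw] at c1
    rw [hGw] at c2 c1
    have : F (α.symm (β z)) - G z = (F (α.symm (β z)) - β z) + (β z - G z) := by abel
    rw [this]
    exact (norm_add_le _ _).trans (by linarith)
  · change ‖β.symm (α (g (G z))) - z‖ ≤ η
    have hz1 : z ∈ closedBall (0 : EC k) (R + 1) := closedBall_subset_closedBall (by linarith) hz
    have hzR : ‖z‖ ≤ R := by simpa using hz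
    set u := g (G z) with hu
    have huR : ‖u‖ ≤ R2 := hbd z hz1
    have hFu : F u = G z := h2.fg _ (hsub (h1.mem z))
    obtain ⟨a1, a2, -⟩ := hαp u (by simpa using huR)
    set v := g (α u) with hv
    have hFv : F v = α u := h2.fg _ a1
    have c1 := hF v (by
      have := tri _ _ _ _ a2 huR
      simp only [mem_closedBall, dist_zero_right]; linarith) u (by
      simp only [mem_closedBall, dist_zero_right]; linarith) (by linarith)
    rw [hFv, hFu] at c1
    obtain ⟨l1, l2⟩ := hlip z hz (α u) (by linarith)
    set y := H (α u) with hy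
    have hGy : G y = α u := h1.fg _ l1
    have l3 : ‖y - z‖ ≤ L * δ := l2.trans (mul_le_mul_of_nonneg_left c1.le hL.le)
    obtain ⟨-, -, b3⟩ := hβp y (by
      have := tri _ _ _ _ l3 hzR
      simp only [mem_closedBall, dist_zero_right]; linarith)
    rw [hGy] at b3
    have : β.symm (α u) - z = (β.symm (α u) - y) + (y - z) := by abel
    rw [this]
    exact (norm_add_le _ _).trans (by linarith)

/-- Admissible data at stage `j`. -/
def Good {k : ℕ} (F g : ℕ → EC k → EC k) (Ω : ℕ → Set (EC k)) (j : ℕ)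
    (s : (EC k ≃ EC k) × ℝ × ℝ) : Prop :=
  IsAut s.1 ∧ 0 < s.2.1 ∧ s.2.1 ≤ (1 / 2) ^ j ∧ (j : ℝ) ≤ s.2.2 ∧
  (∀ w ∈ closedBall (0 : EC k) s.2.2, ∀ y, ‖y - F j (s.1 w)‖ ≤ s.2.1 →
    y ∈ Ω j ∧ ‖s.1.symm (g j y) - w‖ ≤ (1 / 2) ^ j) ∧
  (∀ i ≤ j, ∀ x ∈ closedBall (0 : EC k) j, ‖s.1.symm (g j (F i x))‖ ≤ s.2.2)

lemma exists_good {k : ℕ} {F g : ℕ → EC k → EC k} {Ω : ℕ → Set (EC k)}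
    (h : ∀ j, Bih (F j) (g j) (Ω j)) (hm : Monotone Ω) (j : ℕ) {Φ : EC k ≃ EC k} (hΦ : IsAut Φ)
    {δ0 : ℝ} (hδ0 : 0 < δ0) (R0 : ℝ) : ∃ δ ≤ δ0, ∃ R ≥ R0, Good F g Ω j (Φ, δ, R) := by
  have hB := (h j).comp_aut hΦ
  have hb : ∀ i, ∃ M > 0, i ≤ j → ∀ x ∈ closedBall (0 : EC k) j, ‖Φ.symm (g j (F i x))‖ ≤ M := by
    intro i
    by_cases hij : i ≤ j
    · have hc : Continuous (fun x => Φ.symm (g j (F i x))) :=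
        hB.hg.continuousOn.comp_continuous (h i).hf.continuous (fun z => hm hij ((h i).mem z))
      obtain ⟨M, hM, hM2⟩ := cont_bdd hc j
      exact ⟨M, hM, fun _ => hM2⟩
    · exact ⟨1, one_pos, fun h => absurd h hij⟩
  choose M hM0 hM using hb
  set R := max (max R0 j) (∑ i ∈ Finset.range (j + 1), M i) with hR
  obtain ⟨ρ, hρ, L, hL, hlip⟩ := loc_lip hB R
  set δ := min (min δ0 ((1 / 2) ^ j)) (min ρ ((1 / 2) ^ j / L)) with hδ
  have hδL : δ ≤ (1 / 2) ^ j / L := (min_le_right _ _).trans (min_le_right _ _)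
  have hδρ : δ ≤ ρ := (min_le_right _ _).trans (min_le_left _ _)
  refine ⟨δ, (min_le_left _ _).trans (min_le_left _ _), R,
    (le_max_left _ _).trans (le_max_left _ _), hΦ, by positivity,
    (min_le_left _ _).trans (min_le_right _ _), (le_max_right _ _).trans (le_max_left _ _), ?_, ?_⟩
  · intro w hw y hy
    obtain ⟨l1, l2⟩ := hlip w hw y (hy.trans hδρ)
    refine ⟨l1, l2.trans ?_⟩
    rw [le_div_iff₀ hL] at hδL
    have := mul_le_mul_of_nonneg_left hy hL.le
    simp only at this
    linarith
  · intro i hi x hx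
    refine (hM i hi x hx).trans (le_trans ?_ (le_max_right _ _))
    exact Finset.single_le_sum (f := M) (fun i _ => (hM0 i).le) (Finset.mem_range.2 (by omega))

/-- Relation between consecutive stages. -/
def StageRel {k : ℕ} (F g : ℕ → EC k → EC k) (j : ℕ) (s s' : (EC k ≃ EC k) × ℝ × ℝ) : Prop :=
  s'.2.1 ≤ s.2.1 / 2 ∧ s.2.2 ≤ s'.2.2 ∧ ∀ z ∈ closedBall (0 : EC k) s.2.2,
    ‖F (j + 1) (s'.1 z) - F j (s.1 z)‖ ≤ s.2.1 / 2 ∧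
    ‖s'.1.symm (g (j + 1) (F j (s.1 z))) - z‖ ≤ (1 / 2) ^ j

lemma exists_next {k : ℕ} (hk : 2 ≤ k) {F g : ℕ → EC k → EC k} {Ω : ℕ → Set (EC k)}
    (h : ∀ j, Bih (F j) (g j) (Ω j)) (hm : Monotone Ω) (hr : ∀ j, RungeP (Ω j)) (j : ℕ)
    (s : (EC k ≃ EC k) × ℝ × ℝ) (hs : Good F g Ω j s) :
    ∃ s', Good F g Ω (j + 1) s' ∧ StageRel F g j s s' := by
  have hδ := hs.2.1
  obtain ⟨Φ, hΦ, hp⟩ := push_out hk ((h j).comp_aut hs.1) (h (j + 1)) (hm (Nat.le_succ j)) (hr j)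
    (hr (j + 1)) s.2.2 (η := min (s.2.1 / 2) ((1 / 2) ^ j)) (by positivity)
  obtain ⟨δ, hδ1, R, hR, hG⟩ := exists_good h hm (j + 1) hΦ (δ0 := s.2.1 / 2) (by positivity) s.2.2
  exact ⟨(Φ, δ, R), hG, hδ1, hR, fun z hz =>
    ⟨(hp z hz).1.trans (min_le_left _ _), (hp z hz).2.trans (min_le_right _ _)⟩⟩

lemma exists_seq_good {k : ℕ} (hk : 2 ≤ k) {F g : ℕ → EC k → EC k} {Ω : ℕ → Set (EC k)}
    (h : ∀ j, Bih (F j) (g j) (Ω j)) (hm : Monotone Ω) (hr : ∀ j, RungeP (Ω j)) :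
    ∃ s : ℕ → (EC k ≃ EC k) × ℝ × ℝ, (∀ j, Good F g Ω j (s j)) ∧
      ∀ j, StageRel F g j (s j) (s (j + 1)) := by
  obtain ⟨δ, -, R, -, hG⟩ := exists_good h hm 0 (isAut_refl k) one_pos 0
  choose nx hnx using exists_next hk h hm hr
  let S : ∀ j, {s // Good F g Ω j s} := fun j => Nat.rec (motive := fun j => {s // Good F g Ω j s})
    ⟨_, hG⟩ (fun j s => ⟨nx j s.1 s.2, (hnx j s.1 s.2).1⟩) j
  exact ⟨fun j => (S j).1, fun j => (S j).2, fun j => (hnx j (S j).1 (S j).2).2⟩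

open scoped Topology in
lemma main_limit {k : ℕ} (hk : 2 ≤ k) {F g : ℕ → EC k → EC k} {Ω : ℕ → Set (EC k)}
    (h : ∀ j, Bih (F j) (g j) (Ω j)) (hm : Monotone Ω) (hr : ∀ j, RungeP (Ω j)) :
    ∃ G : EC k → EC k, Differentiable ℂ G ∧ Function.Injective G ∧ range G = ⋃ j, Ω j := by
  obtain ⟨s, hg, hrel⟩ := exists_seq_good hk h hm hr
  let δ : ℕ → ℝ := fun j => (s j).2.1
  let R : ℕ → ℝ := fun j => (s j).2.2
  let G : ℕ → EC k → EC k := fun j z => F j ((s j).1 z)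
  let H : ℕ → EC k → EC k := fun j y => (s j).1.symm (g j y)
  have hB : ∀ j, Bih (G j) (H j) (Ω j) := fun j => (h j).comp_aut (hg j).1
  have hδ0 : ∀ j, 0 < δ j := fun j => (hg j).2.1
  have hδp : ∀ j, δ j ≤ (1 / 2) ^ j := fun j => (hg j).2.2.1
  have hRj : ∀ j : ℕ, (j : ℝ) ≤ R j := fun j => (hg j).2.2.2.1
  have hloc : ∀ j, ∀ w ∈ closedBall (0 : EC k) (R j), ∀ y, ‖y - G j w‖ ≤ δ j →
    y ∈ Ω j ∧ ‖H j y - w‖ ≤ (1 / 2) ^ j := fun j => (hg j).2.2.2.2.1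
  have hbd : ∀ j : ℕ, ∀ i ≤ j, ∀ x ∈ closedBall (0 : EC k) j, ‖H j (F i x)‖ ≤ R j :=
    fun j => (hg j).2.2.2.2.2
  have hδs : ∀ j, δ (j + 1) ≤ δ j / 2 := fun j => (hrel j).1
  have hRm : Monotone R := monotone_nat_of_le_succ (fun j => (hrel j).2.1)
  have hGs : ∀ j, ∀ z ∈ closedBall (0 : EC k) (R j), ‖G (j + 1) z - G j z‖ ≤ δ j / 2 :=
    fun j z hz => ((hrel j).2.2 z hz).1
  have hHs : ∀ j, ∀ z ∈ closedBall (0 : EC k) (R j), ‖H (j + 1) (G j z) - z‖ ≤ (1 / 2) ^ j :=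
    fun j z hz => ((hrel j).2.2 z hz).2
  have hhalf : Tendsto (fun j : ℕ => ((1 : ℝ) / 2) ^ j) atTop (𝓝 0) :=
    tendsto_pow_atTop_nhds_zero_of_lt_one (by norm_num) (by norm_num)
  have hδt : Tendsto δ atTop (𝓝 0) :=
    squeeze_zero (fun j => (hδ0 j).le) hδp hhalf
  have hdiff : ∀ j, ∀ z ∈ closedBall (0 : EC k) (R j), ∀ n,
      ‖G (j + n) z - G j z‖ ≤ δ j - δ (j + n) := by
    intro j z hz n
    induction n with
    | zero => simp
    | succ n ih =>
      have h1 := hGs (j + n) z (closedBall_subset_closedBall (hRm (Nat.le_add_right j n)) hz)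
      have h2 := hδs (j + n)
      have : G (j + (n + 1)) z - G j z = (G (j + n + 1) z - G (j + n) z) + (G (j + n) z - G j z) := by
        rw [← add_assoc]; abel
      rw [this]
      refine (norm_add_le _ _).trans ?_
      rw [← add_assoc]
      linarith
  have hdiff2 : ∀ j, ∀ z ∈ closedBall (0 : EC k) (R j), ∀ m ≥ j, ‖G m z - G j z‖ ≤ δ j := by
    intro j z hz m hm
    obtain ⟨n, rfl⟩ := Nat.exists_eq_add_of_le hm
    have := hdiff j z hz n
    have := hδ0 (j + n)
    linarith
  have hRex : ∀ z : EC k, ∃ N : ℕ, ∀ j ≥ N, z ∈ closedBall (0 : EC k) (R j) := by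
    intro z
    obtain ⟨N, hN⟩ := exists_nat_ge ‖z‖
    refine ⟨N, fun j hj => ?_⟩
    have : (N : ℝ) ≤ j := by exact_mod_cast hj
    simp only [mem_closedBall, dist_zero_right]
    linarith [hRj j]
  have hlim : ∀ z, ∃ y, Tendsto (fun j => G j z) atTop (𝓝 y) := by
    intro z
    apply cauchySeq_tendsto_of_complete
    obtain ⟨N, hN⟩ := hRex z
    rw [Metric.cauchySeq_iff']
    intro ε hε
    obtain ⟨j, hj1, hj2⟩ := ((hδt.eventually (gt_mem_nhds hε)).and (eventually_ge_atTop N)).exists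
    refine ⟨j, fun n hn => ?_⟩
    rw [dist_eq_norm]
    exact (hdiff2 j z (hN j hj2) n hn).trans_lt hj1
  choose Γ hΓ using hlim
  have hΓδ : ∀ j, ∀ z ∈ closedBall (0 : EC k) (R j), ‖Γ z - G j z‖ ≤ δ j := by
    intro j z hz
    refine le_of_tendsto ((hΓ z).sub_const (G j z)).norm ?_
    filter_upwards [eventually_ge_atTop j] with m hm
    exact hdiff2 j z hz m hm
  have hΓd : Differentiable ℂ Γ := by
    intro z
    obtain ⟨N, hN⟩ := exists_nat_gt ‖z‖
    have : DifferentiableOn ℂ Γ (ball 0 N) := by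
      refine holo_limit isOpen_ball (Eventually.of_forall (fun n => (hB n).hf.differentiableOn)) ?_
      rw [Metric.tendstoUniformlyOn_iff]
      intro ε hε
      filter_upwards [hδt.eventually (gt_mem_nhds hε), eventually_ge_atTop N] with j hj hjN x hx
      rw [dist_eq_norm]
      refine (hΓδ j x ?_).trans_lt hj
      have h1 : ‖x‖ < N := by simpa using hx
      have : (N : ℝ) ≤ j := by exact_mod_cast hjN
      simp only [mem_closedBall, dist_zero_right]
      linarith [hRj j]
    exact this.differentiableAt (isOpen_ball.mem_nhds (by simpa using hN))
  have hΓH : ∀ z, Tendsto (fun j => H j (Γ z)) atTop (𝓝 z) := by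
    intro z
    rw [tendsto_iff_norm_sub_tendsto_zero]
    obtain ⟨N, hN⟩ := hRex z
    refine squeeze_zero' (Eventually.of_forall (fun j => norm_nonneg _)) ?_ hhalf
    filter_upwards [eventually_ge_atTop N] with j hj
    exact (hloc j z (hN j hj) (Γ z) (hΓδ j z (hN j hj))).2
  refine ⟨Γ, hΓd, ?_, ?_⟩
  · intro z w hzw
    have h1 := hΓH z
    rw [hzw] at h1
    exact tendsto_nhds_unique h1 (hΓH w)
  · apply Subset.antisymm
    · rintro _ ⟨z, rfl⟩
      obtain ⟨N, hN⟩ := hRex z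
      exact mem_iUnion.2 ⟨N, (hloc N z (hN N le_rfl) (Γ z) (hΓδ N z (hN N le_rfl))).1⟩
    · intro x hx
      obtain ⟨i, hi⟩ := mem_iUnion.1 hx
      obtain ⟨n0, hn0⟩ := exists_nat_ge ‖g i x‖
      set N := max i n0 with hNdef
      have hHR : ∀ j ≥ N, H j x ∈ closedBall (0 : EC k) (R j) := by
        intro j hj
        have h1 := hbd j i ((le_max_left _ _).trans hj) (g i x) (by
          have : (n0 : ℝ) ≤ j := by exact_mod_cast (le_max_right _ _).trans hj
          simp only [mem_closedBall, dist_zero_right]; linarith)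
        rw [(h i).fg x hi] at h1
        simpa using h1
      have hGH : ∀ j ≥ N, G j (H j x) = x := fun j hj =>
        (hB j).fg x (hm ((le_max_left _ _).trans hj) hi)
      have hc : CauchySeq (fun n => H (N + n) x) := by
        refine cauchySeq_of_le_geometric (1 / 2) 1 (by norm_num) (fun n => ?_)
        have h1 := hHs (N + n) (H (N + n) x) (hHR _ (Nat.le_add_right _ _))
        rw [hGH _ (Nat.le_add_right _ _)] at h1
        rw [dist_eq_norm, norm_sub_rev, one_mul]
        refine h1.trans ?_
        exact pow_le_pow_of_le_one (by norm_num) (by norm_num) (by omega)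
      obtain ⟨w, hw⟩ := cauchySeq_tendsto_of_complete hc
      refine ⟨w, ?_⟩
      have t1 : Tendsto (fun n => Γ (H (N + n) x)) atTop (𝓝 (Γ w)) :=
        (hΓd.continuous.tendsto w).comp hw
      have t2 : Tendsto (fun n => Γ (H (N + n) x)) atTop (𝓝 x) := by
        rw [tendsto_iff_norm_sub_tendsto_zero]
        have hshift : Tendsto (fun n => δ (N + n)) atTop (𝓝 0) := by
          have := (tendsto_add_atTop_iff_nat N).2 hδt
          simpa only [add_comm] using this
        refine squeeze_zero (fun n => norm_nonneg _) (fun n => ?_) hshift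
        have h1 := hΓδ (N + n) (H (N + n) x) (hHR _ (Nat.le_add_right _ _))
        rwa [hGH _ (Nat.le_add_right _ _)] at h1
      exact tendsto_nhds_unique t1 t2

theorem increasing_union_of_Runge_Cks_is_Ck (k : ℕ) (hk : 2 ≤ k)
    (Ω : ℕ → Set (EuclideanSpace ℂ (Fin k)))
    (hmono : ∀ j, Ω j ⊆ Ω (j + 1))
    (hopen : ∀ j, IsOpen (Ω j))
    (hRunge : ∀ j, IsRunge (Ω j))
    (hbiho : ∀ j, ∃ F : EuclideanSpace ℂ (Fin k) → EuclideanSpace ℂ (Fin k),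
      Differentiable ℂ F ∧ Function.Injective F ∧ Set.range F = Ω j) :
    ∃ F : EuclideanSpace ℂ (Fin k) → EuclideanSpace ℂ (Fin k),
      Differentiable ℂ F ∧ Function.Injective F ∧ Set.range F = ⋃ j, Ω j := by
  choose F hF hinj hran using hbiho
  refine main_limit (F := F) (g := fun j => Function.invFun (F j)) hk (fun j => ?_)
    (monotone_nat_of_le_succ hmono) hRunge
  exact
    { hf := hF j
      hΩ := hopen j
      hg := by
        have := inverse_holo (hF j) (hinj j)
        rwa [hran j] at this
      mem := fun z => by rw [← hran j]; exact Set.mem_range_self z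
      gf := fun z => Function.leftInverse_invFun (hinj j) z
      fg := fun y hy => by
        rw [← hran j] at hy
        exact Function.invFun_eq hy }
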